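/- Let (G, S, R, v, P_k(v), Q, k) be a minimal counterexample to the Extension Theorem, let W be the set of neighbors of v that are not in S ∪ R, and let G' = G − v − W. Then (S ∪ R) − {v} is at most (6k−1)-edge-connected in G', i.e., (S ∪ R) − {v} is not 6k-edge-connected in G'. -/

import Mathlib

/-!
Multigraphs are modelled by a vertex type `V`, an edge type `E`, and an
incidence map `ends : E → Sym2 V` giving the (unordered) pair of endpoints
of each edge.  Subgraphs are identified with their edge sets (`Set E`).
-/

namespace SteinerPacking

variable {V E : Type}

/-- The set of edges incident to a vertex `u` (denoted `E(u)` in the paper). -/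
def incEdges (ends : E → Sym2 V) (u : V) : Set E := {e | u ∈ ends e}

/-- The degree `d(u) = |E(u)|` of a vertex. -/
noncomputable def deg (ends : E → Sym2 V) (u : V) : ℕ := (incEdges ends u).ncard

/-- One step along an edge of the edge set `F`. -/
def Step (ends : E → Sym2 V) (F : Set E) (a b : V) : Prop := ∃ e ∈ F, ends e = s(a, b)

/-- `a` and `b` are joined by a walk using only edges in `F`. -/
def Reaches (ends : E → Sym2 V) (F : Set E) (a b : V) : Prop :=
  Relation.ReflTransGen (Step ends F) a b

/-- The vertex set `S` is connected in the subgraph with edge set `F`. -/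
def ConnectsSet (ends : E → Sym2 V) (F : Set E) (S : Set V) : Prop :=
  ∀ a ∈ S, ∀ b ∈ S, Reaches ends F a b

/-- A walk from `u` to `w` given by a list of edges. -/
inductive IsWalk (ends : E → Sym2 V) : V → V → List E → Prop
  | nil (v : V) : IsWalk ends v v []
  | cons {u v w : V} {e : E} {l : List E} :
      ends e = s(u, v) → IsWalk ends v w l → IsWalk ends u w (e :: l)

/-- A path from `u` to `v` using edges of `F` (a walk with no repeated edges). -/
def IsPathIn (ends : E → Sym2 V) (F : Set E) (u v : V) (l : List E) : Prop :=
  IsWalk ends u v l ∧ l.Nodup ∧ ∀ e ∈ l, e ∈ F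

/-- There are `n` pairwise edge-disjoint paths from `u` to `v` inside `F`. -/
def EdgeDisjointPathsIn (ends : E → Sym2 V) (F : Set E) (n : ℕ) (u v : V) : Prop :=
  ∃ P : Fin n → List E, (∀ i, IsPathIn ends F u v (P i)) ∧
    ∀ i j, i ≠ j → ∀ e ∈ P i, e ∉ P j

/-- `S` is `n`-edge-connected in the (sub)graph with edge set `F`:
any two distinct vertices of `S` are joined by `n` edge-disjoint paths. -/
def EdgeConnectedIn (ends : E → Sym2 V) (F : Set E) (S : Set V) (n : ℕ) : Prop :=
  ∀ a ∈ S, ∀ b ∈ S, a ≠ b → EdgeDisjointPathsIn ends F n a b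

/-- A family of subgraphs (edge sets) is pairwise edge-disjoint. -/
def PairwiseEdgeDisjoint {k : ℕ} (H : Fin k → Set E) : Prop :=
  ∀ i j, i ≠ j → Disjoint (H i) (H j)

/-- `v` is a cut vertex of the subgraph with edge set `H`: some two vertices
distinct from `v` are connected in `H` but not after removing `v`. -/
def IsCutVertexOf (ends : E → Sym2 V) (H : Set E) (v : V) : Prop :=
  ∃ a b : V, a ≠ v ∧ b ≠ v ∧ Reaches ends H a b ∧
    ¬ Reaches ends {e ∈ H | v ∉ ends e} a b

/-- A subpartition of `E(v)` into `k` (possibly empty) parts. -/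
def IsSubpartitionAt {k : ℕ} (ends : E → Sym2 V) (v : V) (P : Fin k → Set E) : Prop :=
  (∀ i, P i ⊆ incEdges ends v) ∧ ∀ i j, i ≠ j → Disjoint (P i) (P j)

/-- A balanced partition of `E(v)` into `k` parts: each part has ≥ 2 edges. -/
def IsBalancedPartitionAt {k : ℕ} (ends : E → Sym2 V) (v : V) (P : Fin k → Set E) : Prop :=
  IsSubpartitionAt ends v P ∧ (⋃ i, P i) = incEdges ends v ∧ ∀ i, 2 ≤ (P i).ncard

/-- A balanced subpartition of `E(v)`: one extendable to a balanced partition. -/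
def IsBalancedSubpartitionAt {k : ℕ} (ends : E → Sym2 V) (v : V) (P : Fin k → Set E) : Prop :=
  IsSubpartitionAt ends v P ∧
    ∃ P' : Fin k → Set E, IsBalancedPartitionAt ends v P' ∧ ∀ i, P i ⊆ P' i

/-- The subgraphs `H 1, …, H k` extend the subpartition `P` at `v`:
`P i ⊆ H i` and `v` is not a cut vertex of any `H i`. -/
def Extend {k : ℕ} (ends : E → Sym2 V) (v : V) (P H : Fin k → Set E) : Prop :=
  ∀ i, P i ⊆ H i ∧ ¬ IsCutVertexOf ends (H i) v

/-- The subgraphs `H 1, …, H k` balance the vertex `u`. -/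
def BalanceVertex {k : ℕ} (ends : E → Sym2 V) (H : Fin k → Set E) (u : V) : Prop :=
  IsBalancedSubpartitionAt ends u (fun i => incEdges ends u ∩ H i)

/-- The subgraphs `H 1, …, H k` balance every vertex of `T`. -/
def BalanceSet {k : ℕ} (ends : E → Sym2 V) (H : Fin k → Set E) (T : Set V) : Prop :=
  ∀ u ∈ T, BalanceVertex ends H u

/-- A loopless multigraph. -/
def Loopless (ends : E → Sym2 V) : Prop := ∀ e : E, ¬ (ends e).IsDiag

/-- The set of neighbors of a vertex. -/
def neighbors (ends : E → Sym2 V) (u : V) : Set V := {w | ∃ e, ends e = s(u, w)}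

/-- There is no family of `k` pairwise edge-disjoint `S`-subgraphs that
balance `S ∪ R` and extend the subpartition `P` at `v`. -/
def NoGoodPacking {k : ℕ} (ends : E → Sym2 V) (S R : Set V) (v : V)
    (P : Fin k → Set E) : Prop :=
  ¬ ∃ H : Fin k → Set E, PairwiseEdgeDisjoint H ∧ (∀ i, ConnectsSet ends (H i) S) ∧
      BalanceSet ends H (S ∪ R) ∧ Extend ends v P H

/-- `(G, S, R, v, P, Q, k)` is a counterexample to the Extension Theorem:
it satisfies all hypotheses of the Extension Theorem (including that every
label appears at least twice at `v`), yet admits no good packing. -/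
def ExtCex (Q k : ℕ) (ends : E → Sym2 V) (S R : Set V) (v : V)
    (P : Fin k → Set E) : Prop :=
  36 ≤ Q ∧ 0 < k ∧ Disjoint S R ∧ 2 ≤ S.ncard ∧
  EdgeConnectedIn ends Set.univ S (Q * k) ∧
  (∀ r ∈ R, (Q - 2) * k ≤ deg ends r) ∧
  v ∈ S ∧ (∀ e : E, v ∈ ends e → ¬ (ends e).IsDiag) ∧
  deg ends v = Q * k ∧
  IsBalancedSubpartitionAt ends v P ∧ (∀ i, 2 ≤ (P i).ncard) ∧
  NoGoodPacking ends S R v P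

/-- The measure used for minimality: number of vertices plus number of
non-loop edges. -/
noncomputable def extMeasure (ends : E → Sym2 V) : ℕ :=
  Nat.card V + {e : E | ¬ (ends e).IsDiag}.ncard

/-- A minimal counterexample to the Extension Theorem: a counterexample whose
measure is at most the measure of every counterexample (with the same `Q`, `k`). -/
def MinExtCex (Q k : ℕ) (ends : E → Sym2 V) (S R : Set V) (v : V)
    (P : Fin k → Set E) : Prop :=
  ExtCex Q k ends S R v P ∧
  ∀ (V' E' : Type) (_ : Finite V') (_ : Finite E') (ends' : E' → Sym2 V')
    (S' R' : Set V') (v' : V') (P' : Fin k → Set E'),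
    ExtCex Q k ends' S' R' v' P' → extMeasure ends ≤ extMeasure ends'

section Basic

variable {ends ends' : E → Sym2 V} {F F' : Set E} {a b c : V}

/-- The set of edges with one endpoint in `X` and the other one outside of `X`. -/
def cut (ends : E → Sym2 V) (X : Set V) : Set E :=
  {e | (∃ z ∈ ends e, z ∈ X) ∧ ∃ z ∈ ends e, z ∉ X}

lemma exists_ends (ends : E → Sym2 V) (e : E) : ∃ a b, ends e = s(a, b) := by
  induction h : ends e with
  | h a b => exact ⟨a, b, rfl⟩

lemma mem_cut_iff {e : E} {X : Set V} (h : ends e = s(a, b)) :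
    e ∈ cut ends X ↔ ¬ (a ∈ X ↔ b ∈ X) := by
  simp only [cut, Set.mem_ofPred_eq, h, Sym2.mem_iff, exists_eq_or_imp, exists_eq_left]
  tauto

lemma cut_compl (X : Set V) : cut ends Xᶜ = cut ends X := by
  ext e
  obtain ⟨a, b, h⟩ := exists_ends ends e
  simp only [mem_cut_iff h, Set.mem_compl_iff]
  tauto

lemma Reaches.refl (a : V) : Reaches ends F a a := Relation.ReflTransGen.refl

lemma Reaches.trans (h : Reaches ends F a b) (h' : Reaches ends F b c) :
    Reaches ends F a c := Relation.ReflTransGen.trans h h'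

lemma Reaches.of_edge {e : E} (he : e ∈ F) (h : ends e = s(a, b)) : Reaches ends F a b :=
  Relation.ReflTransGen.single ⟨e, he, h⟩

lemma Reaches.symm (h : Reaches ends F a b) : Reaches ends F b a := by
  induction h with
  | refl => exact .refl _
  | tail _ h ih =>
    obtain ⟨e, he, h⟩ := h
    exact (Reaches.of_edge he (h.trans Sym2.eq_swap)).trans ih

/-- Transport of walks along a vertex map under which every edge of `F` becomes a walk. -/
lemma Reaches.lift (φ : V → V)
    (hφ : ∀ e ∈ F, ∀ a b, ends e = s(a, b) → Reaches ends' F' (φ a) (φ b))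
    (h : Reaches ends F a b) : Reaches ends' F' (φ a) (φ b) := by
  induction h with
  | refl => exact .refl _
  | tail _ h ih =>
    obtain ⟨e, he, h⟩ := h
    exact ih.trans (hφ e he _ _ h)

lemma Reaches.mono (hF : F ⊆ F') (h : Reaches ends F a b) : Reaches ends F' a b :=
  h.lift id fun _ he _ _ h => .of_edge (hF he) h

lemma Reaches.exists_mem_cut {X : Set V} (h : Reaches ends F a b) (ha : a ∈ X) (hb : b ∉ X) :
    ∃ e ∈ F, e ∈ cut ends X := by
  induction h with
  | refl => exact absurd ha hb
  | @tail c d _ h ih =>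
    obtain ⟨e, he, h⟩ := h
    by_cases hc : c ∈ X
    · exact ⟨e, he, (mem_cut_iff h).2 (by tauto)⟩
    · exact ih hc

lemma Reaches.exists_incident (h : Reaches ends F a b) (hab : a ≠ b) :
    ∃ e ∈ F, a ∈ ends e := by
  obtain ⟨e, he, ⟨z, hz, rfl⟩, -⟩ := h.exists_mem_cut (X := {a}) rfl (by simpa using hab.symm)
  exact ⟨e, he, hz⟩

/-- A walk can be shortened so that it never returns to its first vertex. -/
lemma Reaches.leave (h : Reaches ends F a b) :
    a = b ∨ ∃ e ∈ F, ∃ c, ends e = s(a, c) ∧ Reaches ends (F \ incEdges ends a) c b := by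
  induction h with
  | refl => exact .inl rfl
  | @tail d b _ h ih =>
    obtain ⟨e, he, h⟩ := h
    by_cases hab : a = b
    · exact .inl hab
    right
    by_cases had : a = d
    · subst had
      exact ⟨e, he, b, h, .refl _⟩
    obtain rfl | ⟨e', he', c, hc, hr⟩ := ih
    · exact absurd rfl had
    · refine ⟨e', he', c, hc, hr.trans (.of_edge ⟨he, ?_⟩ h)⟩
      simp [incEdges, h, hab, had]

lemma IsWalk.reaches {l : List E} (h : IsWalk ends a b l) : Reaches ends {e | e ∈ l} a b := by
  induction h with
  | nil => exact .refl _
  | cons h _ ih =>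
    exact (Reaches.of_edge (by simp) h).trans
      (ih.mono fun e he => List.mem_cons_of_mem _ he)

lemma Reaches.exists_path [Finite E] (h : Reaches ends F a b) :
    ∃ l, IsPathIn ends F a b l := by
  induction hn : F.ncard using Nat.strong_induction_on generalizing F a with
  | _ n ih =>
    obtain rfl | ⟨e, he, c, hc, hr⟩ := h.leave
    · exact ⟨[], .nil _, by simp, by simp⟩
    have hea : e ∈ incEdges ends a := by simp [incEdges, hc]
    obtain ⟨l, hl, hl', hlF⟩ := ih _ (hn ▸ Set.ncard_lt_ncard
      ⟨Set.sdiff_subset, fun hF => (hF he).2 hea⟩) hr rfl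
    refine ⟨e :: l, .cons hc hl, List.nodup_cons.2 ⟨fun h => (hlF e h).2 hea, hl'⟩, ?_⟩
    rintro e' (_ | ⟨_, h'⟩)
    · exact he
    · exact (hlF _ h').1

lemma edgeDisjointPathsIn_iff [Finite E] {n : ℕ} :
    EdgeDisjointPathsIn ends F n a b ↔ ∃ D : Fin n → Set E,
      PairwiseEdgeDisjoint D ∧ (∀ j, D j ⊆ F) ∧ ∀ j, Reaches ends (D j) a b := by
  constructor
  · rintro ⟨P, hP, hd⟩
    exact ⟨fun j => {e | e ∈ P j}, fun i j hij => Set.disjoint_left.2 (hd i j hij),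
      fun j => (hP j).2.2, fun j => (hP j).1.reaches⟩
  · rintro ⟨D, hd, hDF, hD⟩
    choose P hP using fun j => (hD j).exists_path
    exact ⟨P, fun j => ⟨(hP j).1, (hP j).2.1, fun e he => hDF j ((hP j).2.2 e he)⟩,
      fun i j hij e he he' =>
        Set.disjoint_left.1 (hd i j hij) ((hP i).2.2 e he) ((hP j).2.2 e he')⟩

lemma EdgeDisjointPathsIn.le_ncard_cut [Finite E] {n : ℕ} {X : Set V}
    (h : EdgeDisjointPathsIn ends F n a b) (ha : a ∈ X) (hb : b ∉ X) :
    n ≤ (cut ends X ∩ F).ncard := by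
  obtain ⟨D, hd, hDF, hD⟩ := edgeDisjointPathsIn_iff.1 h
  choose f hf hfc using fun j => (hD j).exists_mem_cut ha hb
  have hinj : Function.Injective f := by
    intro i j hij
    by_contra hne
    exact Set.disjoint_left.1 (hd i j hne) (hf i) (hij ▸ hf j)
  calc n = (Set.range f).ncard := by
        rw [← Set.image_univ, Set.ncard_image_of_injective _ hinj, Set.ncard_univ,
          Nat.card_fin]
    _ ≤ _ := Set.ncard_le_ncard (by rintro _ ⟨j, rfl⟩; exact ⟨hfc j, hDF j (hf j)⟩)

lemma EdgeConnectedIn.le_ncard_cut [Finite E] {n : ℕ} {S X : Set V}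
    (h : EdgeConnectedIn ends F S n) (h₁ : (X ∩ S).Nonempty) (h₂ : (S \ X).Nonempty) :
    n ≤ (cut ends X ∩ F).ncard := by
  obtain ⟨a, haX, haS⟩ := h₁
  obtain ⟨b, hbS, hbX⟩ := h₂
  exact (h a haS b hbS (by rintro rfl; exact hbX haX)).le_ncard_cut haX hbX

end Basic

section Menger

variable {src tgt : E → V}

/-- A step from `a` to `b` along a signed edge: `(e, true)` is `e` traversed from source to
target, `(e, false)` is `e` traversed backwards. -/
def DStep (src tgt : E → V) (A : Set (E × Bool)) (a b : V) : Prop :=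
  ∃ e, ((e, true) ∈ A ∧ src e = a ∧ tgt e = b) ∨ ((e, false) ∈ A ∧ tgt e = a ∧ src e = b)

lemma DStep.leave {A : Set (E × Bool)} {a b : V}
    (h : Relation.ReflTransGen (DStep src tgt A) a b) :
    a = b ∨ ∃ c, DStep src tgt A a c ∧
      Relation.ReflTransGen (DStep src tgt {d ∈ A | src d.1 ≠ a ∧ tgt d.1 ≠ a}) c b := by
  induction h with
  | refl => exact .inl rfl
  | @tail d b _ h ih =>
    by_cases hab : a = b
    · exact .inl hab
    right
    obtain rfl | ⟨c, hc, hr⟩ := ih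
    · exact ⟨b, h, .refl⟩
    by_cases had : a = d
    · subst had
      exact ⟨b, h, .refl⟩
    · refine ⟨c, hc, hr.tail ?_⟩
      obtain ⟨e, ⟨he, rfl, rfl⟩ | ⟨he, rfl, rfl⟩⟩ := h
      · exact ⟨e, .inl ⟨⟨he, Ne.symm had, Ne.symm hab⟩, rfl, rfl⟩⟩
      · exact ⟨e, .inr ⟨⟨he, Ne.symm hab, Ne.symm had⟩, rfl, rfl⟩⟩

open Classical in
/-- The net outflow at `u` of the flow `f`. -/
noncomputable def excess [Fintype E] (src tgt : E → V) (f : E → ℤ) (u : V) : ℤ :=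
  ∑ e, f e * ((if src e = u then 1 else 0) - (if tgt e = u then 1 else 0))

lemma excess_add [Fintype E] (f g : E → ℤ) (u : V) :
    excess src tgt (f + g) u = excess src tgt f u + excess src tgt g u := by
  simp only [excess, Pi.add_apply, add_mul, Finset.sum_add_distrib]

lemma excess_sub [Fintype E] (f g : E → ℤ) (u : V) :
    excess src tgt (f - g) u = excess src tgt f u - excess src tgt g u := by
  simp only [excess, Pi.sub_apply, sub_mul, Finset.sum_sub_distrib]

open Classical in
lemma sum_excess [Fintype V] [Fintype E] (f : E → ℤ) (X : Set V) :
    ∑ u, (if u ∈ X then excess src tgt f u else 0) =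
      ∑ e, f e * ((if src e ∈ X then 1 else 0) - (if tgt e ∈ X then 1 else 0)) := by
  have h : ∀ u, (if u ∈ X then excess src tgt f u else 0) = ∑ e, (if u ∈ X then
      f e * ((if src e = u then 1 else 0) - (if tgt e = u then 1 else 0)) else 0) := by
    intro u
    split_ifs <;> simp [excess]
  simp only [h]
  rw [Finset.sum_comm]
  refine Finset.sum_congr rfl fun e _ => ?_
  have h' : ∀ u, (if u ∈ X then
      f e * ((if src e = u then 1 else 0) - (if tgt e = u then 1 else 0)) else (0 : ℤ)) =
      (if src e = u then (if src e ∈ X then f e else 0) else 0) -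
      (if tgt e = u then (if tgt e ∈ X then f e else 0) else 0) := by
    intro u
    split_ifs <;> simp_all
  simp only [h', Finset.sum_sub_distrib, Finset.sum_ite_eq, Finset.mem_univ, if_true]
  split_ifs <;> simp

open Classical in
/-- A unit flow along a path of allowed signed edges. -/
lemma exists_unit_flow [Fintype E] {ends : E → Sym2 V} (hst : ∀ e, ends e = s(src e, tgt e))
    {A : Set (E × Bool)} {a b : V} (h : Relation.ReflTransGen (DStep src tgt A) a b) :
    ∃ g : E → ℤ, (∀ e, g e = 0 ∨ (g e = 1 ∧ (e, true) ∈ A) ∨ (g e = -1 ∧ (e, false) ∈ A)) ∧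
      (∀ u, excess src tgt g u = (if a = u then 1 else 0) - (if b = u then 1 else 0)) ∧
      Reaches ends {e | g e ≠ 0} a b := by
  induction hn : A.ncard using Nat.strong_induction_on generalizing A a with
  | _ n ih =>
    obtain rfl | ⟨c, ⟨e, he⟩, hr⟩ := DStep.leave h
    · exact ⟨0, by simp, by simp [excess], .refl _⟩
    have hlt : {d ∈ A | src d.1 ≠ a ∧ tgt d.1 ≠ a}.ncard < n := by
      refine hn ▸ Set.ncard_lt_ncard ⟨fun d hd => hd.1, fun hA => ?_⟩
      obtain ⟨he, h1, -⟩ | ⟨he, h1, -⟩ := he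
      · exact (hA he).2.1 h1
      · exact (hA he).2.2 h1
    obtain ⟨g, hg, hgx, hgr⟩ := ih _ hlt hr rfl
    have hge : g e = 0 := by
      obtain h0 | ⟨-, h0⟩ | ⟨-, h0⟩ := hg e
      · exact h0
      all_goals
        obtain ⟨-, h1, -⟩ | ⟨-, h1, -⟩ := he
        · exact absurd h1 h0.2.1
        · exact absurd h1 h0.2.2
    obtain ⟨σ, hσ, hσ', hec⟩ : ∃ σ : ℤ, ((σ = 1 ∧ (e, true) ∈ A) ∨ (σ = -1 ∧ (e, false) ∈ A)) ∧
        (∀ u, σ * ((if src e = u then 1 else 0) - (if tgt e = u then 1 else 0)) =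
          (if a = u then 1 else 0) - (if c = u then 1 else 0)) ∧ ends e = s(a, c) := by
      obtain ⟨he, rfl, rfl⟩ | ⟨he, rfl, rfl⟩ := he
      · exact ⟨1, .inl ⟨rfl, he⟩, by simp, hst e⟩
      · exact ⟨-1, .inr ⟨rfl, he⟩, by simp, (hst e).trans Sym2.eq_swap⟩
    refine ⟨g + Pi.single e σ, fun e' => ?_, fun u => ?_, ?_⟩
    · by_cases h' : e' = e
      · subst h'
        right
        simpa [hge] using hσ
      · have := hg e'
        simp only [Pi.add_apply, Pi.single_eq_of_ne h', add_zero]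
        exact this.imp id (Or.imp (And.imp id And.left) (And.imp id And.left))
    · rw [excess_add, hgx]
      have : excess src tgt (Pi.single e σ) u =
          (if a = u then 1 else 0) - (if c = u then 1 else 0) := by
        rw [← hσ', excess, Finset.sum_eq_single e]
        · simp
        · intro e' _ h'
          simp [Pi.single_eq_of_ne h']
        · simp
      rw [this]
      ring
    · have h0 : σ ≠ 0 := by
        rintro rfl
        simp at hσ
      refine (Reaches.of_edge (e := e) ?_ hec).trans (hgr.mono fun e' he' => ?_)
      · simp [hge, h0]
      · have : e' ≠ e := by
          rintro rfl
          exact he' hge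
        simpa [Pi.single_eq_of_ne this] using he'

open Classical in
/-- `f` is an integer flow of value `n` from `s` to `t`, all edges having capacity one. -/
def IsFlow [Fintype E] (src tgt : E → V) (s t : V) (n : ℕ) (f : E → ℤ) : Prop :=
  (∀ e, f e = 0 ∨ f e = 1 ∨ f e = -1) ∧
    ∀ u, excess src tgt f u = n * ((if s = u then 1 else 0) - (if t = u then 1 else 0))

open Classical in
lemma IsFlow.sum_eq [Fintype V] [Fintype E] {s t : V} {n : ℕ} {f : E → ℤ}
    (hf : IsFlow src tgt s t n f) {X : Set V} (hs : s ∈ X) (ht : t ∉ X) :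
    ∑ e, f e * ((if src e ∈ X then 1 else 0) - (if tgt e ∈ X then 1 else 0)) = (n : ℤ) := by
  rw [← sum_excess, Finset.sum_eq_single s]
  · rw [if_pos hs, hf.2]
    simp [show t ≠ s by rintro rfl; exact ht hs]
  · intro u _ hu
    by_cases hX : u ∈ X
    · rw [if_pos hX, hf.2]
      simp [hu.symm, show t ≠ u by rintro rfl; exact ht hX]
    · simp [hX]
  · simp

lemma exists_flow [Finite V] [Fintype E] {ends : E → Sym2 V}
    (hst : ∀ e, ends e = s(src e, tgt e)) {s t : V} {n : ℕ}
    (hcut : ∀ X : Set V, s ∈ X → t ∉ X → n ≤ (cut ends X).ncard) :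
    ∀ c ≤ n, ∃ f, IsFlow src tgt s t c f := by
  classical
  have := Fintype.ofFinite V
  intro c
  induction c with
  | zero => exact fun _ => ⟨0, by simp, by simp [excess]⟩
  | succ c ih =>
    intro hc
    obtain ⟨f, hf⟩ := ih (by omega)
    set A : Set (E × Bool) := {d | (d.2 = true ∧ f d.1 ≤ 0) ∨ (d.2 = false ∧ 0 ≤ f d.1)}
      with hA
    by_cases hr : Relation.ReflTransGen (DStep src tgt A) s t
    · obtain ⟨g, hg, hgx, -⟩ := exists_unit_flow hst hr
      refine ⟨f + g, fun e => ?_, fun u => ?_⟩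
      · have h1 := hf.1 e
        have h2 := hg e
        simp [hA] at h2
        simp only [Pi.add_apply]
        omega
      · rw [excess_add, hf.2, hgx]
        push_cast
        ring
    · exfalso
      set X : Set V := {u | Relation.ReflTransGen (DStep src tgt A) s u} with hX
      have h1 := hcut X .refl hr
      have h2 := hf.sum_eq (X := X) .refl hr
      have h3 : ∀ e, f e * ((if src e ∈ X then 1 else 0) - (if tgt e ∈ X then 1 else 0)) =
          if e ∈ cut ends X then 1 else 0 := by
        intro e
        rw [mem_cut_iff (hst e)]
        have h4 := hf.1 e
        by_cases hs : src e ∈ X <;> by_cases ht : tgt e ∈ X <;> simp only [hs, ht] <;> simp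
        · by_contra h5
          exact ht (Relation.ReflTransGen.tail hs
            ⟨e, .inl ⟨.inl ⟨rfl, show f e ≤ 0 by omega⟩, rfl, rfl⟩⟩)
        · by_contra h5
          exact hs (Relation.ReflTransGen.tail ht
            ⟨e, .inr ⟨.inr ⟨rfl, show 0 ≤ f e by omega⟩, rfl, rfl⟩⟩)
      rw [Finset.sum_congr rfl fun e _ => h3 e, Finset.sum_boole] at h2
      rw [Set.ncard_eq_toFinset_card'] at h1
      have h6 : (cut ends X).toFinset = Finset.univ.filter (· ∈ cut ends X) := by
        ext; simp
      rw [h6] at h1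
      norm_cast at h2
      omega

lemma IsFlow.exists_paths [Finite V] [Fintype E] {ends : E → Sym2 V}
    (hst : ∀ e, ends e = s(src e, tgt e)) {s t : V} {n : ℕ} {f : E → ℤ}
    (hf : IsFlow src tgt s t n f) : ∃ D : Fin n → Set E, PairwiseEdgeDisjoint D ∧
      (∀ j, D j ⊆ {e | f e ≠ 0}) ∧ ∀ j, Reaches ends (D j) s t := by
  classical
  have := Fintype.ofFinite V
  induction n generalizing f with
  | zero => exact ⟨fun _ => ∅, fun i => i.elim0, fun i => i.elim0, fun i => i.elim0⟩
  | succ n ih =>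
    set A : Set (E × Bool) := {d | (d.2 = true ∧ f d.1 = 1) ∨ (d.2 = false ∧ f d.1 = -1)}
      with hA
    by_cases hr : Relation.ReflTransGen (DStep src tgt A) s t
    · obtain ⟨g, hg, hgx, hgr⟩ := exists_unit_flow hst hr
      have hfg : ∀ e, g e = 0 ∨ g e = f e := by
        intro e
        have h2 := hg e
        simp [hA] at h2
        omega
      have hf' : IsFlow src tgt s t n (f - g) := by
        refine ⟨fun e => ?_, fun u => ?_⟩
        · have h1 := hf.1 e
          have h2 := hfg e
          simp only [Pi.sub_apply]
          omega
        · rw [excess_sub, hf.2, hgx]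
          push_cast
          ring
      obtain ⟨D, hd, hDf, hD⟩ := ih hf'
      have hdg : ∀ j, Disjoint (D j) {e | g e ≠ 0} := by
        intro j
        refine Set.disjoint_left.2 fun e he hge => ?_
        have h1 := hDf j he
        have h2 := hfg e
        simp only [Set.mem_ofPred_eq, Pi.sub_apply] at h1 hge
        omega
      refine ⟨Fin.cons {e | g e ≠ 0} D, ?_, ?_, ?_⟩
      · intro i j
        refine Fin.cases ?_ (fun i => ?_) i <;> refine Fin.cases ?_ (fun j => ?_) j
        · simp
        · intro _
          simpa using (hdg j).symm
        · intro _
          simpa using hdg i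
        · intro hij
          simpa using hd i j (by simpa using hij)
      · intro j
        refine Fin.cases ?_ (fun j => ?_) j
        · intro e he
          have h2 := hfg e
          simp only [Fin.cons_zero, Set.mem_ofPred_eq] at he ⊢
          omega
        · intro e he
          have h1 := hDf j he
          have h2 := hfg e
          simp only [Set.mem_ofPred_eq, Pi.sub_apply] at h1 ⊢
          omega
      · intro j
        refine Fin.cases ?_ (fun j => ?_) j
        · simpa using hgr
        · simpa using hD j
    · exfalso
      set X : Set V := {u | Relation.ReflTransGen (DStep src tgt A) s u} with hX
      have h2 := hf.sum_eq (X := X) .refl hr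
      have h3 : ∀ e ∈ Finset.univ,
          f e * ((if src e ∈ X then 1 else 0) - (if tgt e ∈ X then 1 else 0)) ≤ 0 := by
        intro e _
        have h4 := hf.1 e
        by_cases hs : src e ∈ X <;> by_cases ht : tgt e ∈ X <;> simp only [hs, ht] <;> simp
        · by_contra h5
          exact ht (Relation.ReflTransGen.tail hs
            ⟨e, .inl ⟨.inl ⟨rfl, show f e = 1 by omega⟩, rfl, rfl⟩⟩)
        · by_contra h5
          exact hs (Relation.ReflTransGen.tail ht
            ⟨e, .inr ⟨.inr ⟨rfl, show f e = -1 by omega⟩, rfl, rfl⟩⟩)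
      have := Finset.sum_nonpos h3
      push_cast at h2
      omega

/-- **Menger's theorem**, edge version for multigraphs. -/
theorem edgeDisjointPathsIn_of_le_ncard_cut [Finite V] [Finite E] {ends : E → Sym2 V} {s t : V}
    {n : ℕ} (hcut : ∀ X : Set V, s ∈ X → t ∉ X → n ≤ (cut ends X).ncard) :
    EdgeDisjointPathsIn ends Set.univ n s t := by
  have := Fintype.ofFinite E
  choose src tgt hst using exists_ends ends
  obtain ⟨f, hf⟩ := exists_flow hst hcut n le_rfl
  obtain ⟨D, hd, -, hD⟩ := hf.exists_paths hst
  exact edgeDisjointPathsIn_iff.2 ⟨D, hd, fun _ => Set.subset_univ _, hD⟩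

end Menger

section HypergraphPacking

lemma Reaches.congr {ends ends' : E → Sym2 V} {F : Set E} {a b : V}
    (h : Reaches ends F a b) (he : ∀ e ∈ F, ends e = ends' e) : Reaches ends' F a b :=
  h.lift id fun e h' _ _ hab => .of_edge h' ((he e h').symm.trans hab)

lemma Reaches.of_insert {ends : E → Sym2 V} {D : Set E} {d : E} {x y a b : V}
    (h : Reaches ends (insert d D) x y) (hd : ends d = s(a, b)) :
    Reaches ends D x y ∨ (Reaches ends D x a ∧ Reaches ends D b y) ∨
      (Reaches ends D x b ∧ Reaches ends D a y) := by
  induction h with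
  | refl => exact .inl (.refl _)
  | @tail u w _ h ih =>
    obtain ⟨e, rfl | he, h⟩ := h
    · rw [h, Sym2.eq_iff] at hd
      obtain ⟨rfl, rfl⟩ | ⟨rfl, rfl⟩ := hd
      · obtain ih | ⟨ih, -⟩ | ⟨ih, -⟩ := ih
        · exact .inr (.inl ⟨ih, .refl _⟩)
        · exact .inr (.inl ⟨ih, .refl _⟩)
        · exact .inl ih
      · obtain ih | ⟨ih, -⟩ | ⟨ih, -⟩ := ih
        · exact .inr (.inr ⟨ih, .refl _⟩)
        · exact .inl ih
        · exact .inr (.inr ⟨ih, .refl _⟩)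
    · have huw : Reaches ends D u w := .of_edge he h
      exact ih.imp (·.trans huw) (Or.imp (And.imp id (·.trans huw)) (And.imp id (·.trans huw)))

/-- In a multigraph on the quotient `Quot r` all of whose edges `A` are bridges, the number of
edges plus the number of components is at most the number of vertices. -/
lemma ncard_add_card_quot_le {τ I : Type} [Finite τ] [Finite I] (r : τ → τ → Prop)
    (p q : I → τ) (A : Set I)
    (hA : ∀ i ∈ A, ¬ Relation.EqvGen
      (fun a b => r a b ∨ ∃ i' ∈ A \ {i}, a = p i' ∧ b = q i') (p i) (q i)) :
    A.ncard + Nat.card (Quot fun a b => r a b ∨ ∃ i ∈ A, a = p i ∧ b = q i) ≤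
      Nat.card (Quot r) := by
  induction A, A.toFinite using Set.Finite.induction_on with
  | empty => simp
  | @insert i A hi _ ih =>
    rw [Set.ncard_insert_of_notMem hi]
    have h1 := ih fun i' hi' h' => hA i' (.inr hi') (Relation.EqvGen.mono (by
      rintro a b (h | ⟨i'', h, h3⟩)
      · exact .inl h
      · exact .inr ⟨i'', ⟨.inr h.1, h.2⟩, h3⟩) _ _ h')
    have h2 : ∀ a b, (r a b ∨ ∃ i' ∈ A, a = p i' ∧ b = q i') →
        (r a b ∨ ∃ i' ∈ insert i A, a = p i' ∧ b = q i') := by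
      rintro a b (h | ⟨i'', h, h3⟩)
      · exact .inl h
      · exact .inr ⟨i'', .inr h, h3⟩
    have := Fintype.ofFinite (Quot fun a b => r a b ∨ ∃ i' ∈ A, a = p i' ∧ b = q i')
    have := Fintype.ofFinite (Quot fun a b => r a b ∨ ∃ i' ∈ insert i A, a = p i' ∧ b = q i')
    have hsurj : Function.Surjective
        (Quot.map (ra := fun a b => r a b ∨ ∃ i' ∈ A, a = p i' ∧ b = q i')
          (rb := fun a b => r a b ∨ ∃ i' ∈ insert i A, a = p i' ∧ b = q i') id h2) := by
      rintro ⟨a⟩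
      exact ⟨Quot.mk _ a, rfl⟩
    have h3 := Fintype.card_lt_of_surjective_not_injective _ hsurj (by
        intro hinj
        have h4 := @hinj (Quot.mk _ (p i)) (Quot.mk _ (q i))
          (Quot.sound (.inr ⟨i, .inl rfl, rfl, rfl⟩))
        refine hA i (.inl rfl) (Relation.EqvGen.mono ?_ _ _ (Quot.eqvGen_exact h4))
        rintro a b (h | ⟨i'', h, h3⟩)
        · exact .inl h
        · exact .inr ⟨i'', ⟨.inr h, by rintro rfl; exact hi h⟩, h3⟩)
    simp only [← Nat.card_eq_fintype_card] at h3
    omega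

variable {τ I : Type} {m : ℕ}

/-- Connectivity inside the color class `j` restricted to `A`, where every `i` carries a color
and a pair of vertices. -/
def Conn (σ : I → Fin m × Sym2 τ) (A : Set I) (j : Fin m) (a b : τ) : Prop :=
  Reaches (fun i => (σ i).2) {i ∈ A | (σ i).1 = j} a b

lemma Conn.mono {σ : I → Fin m × Sym2 τ} {A B : Set I} {j : Fin m} {a b : τ}
    (h : Conn σ A j a b) (hAB : A ⊆ B) : Conn σ B j a b :=
  Reaches.mono (fun _ hi => ⟨hAB hi.1, hi.2⟩) h

lemma Conn.congr {σ σ' : I → Fin m × Sym2 τ} {A : Set I} {j : Fin m} {a b : τ}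
    (h : Conn σ A j a b) (hσ : ∀ i ∈ A, σ i = σ' i) : Conn σ' A j a b :=
  (Reaches.congr h (ends' := fun i => (σ' i).2) fun i hi => by rw [hσ i hi.1]).mono
    fun i hi => ⟨hi.1, by rw [← hσ i hi.1, hi.2]⟩

/-- The edge `i` can be removed from its color class without changing connectivity. -/
def Redundant (σ : I → Fin m × Sym2 τ) (i : I) : Prop :=
  ∀ a b, (σ i).2 = s(a, b) → Conn σ {i}ᶜ (σ i).1 a b

lemma Redundant.conn {σ : I → Fin m × Sym2 τ} {i : I} (h : Redundant σ i) {A : Set I}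
    {j : Fin m} {a b : τ} (hc : Conn σ A j a b) : Conn σ {i}ᶜ j a b := by
  refine Reaches.lift id ?_ hc
  rintro i' ⟨-, rfl⟩ a b hab
  by_cases hi : i' = i
  · subst hi
    exact h a b hab
  · exact .of_edge ⟨hi, rfl⟩ hab

/-- Each hyperedge `h i` is represented by a pair of its vertices or by a loop. -/
def Valid (h : I → Set τ) (σ : I → Fin m × Sym2 τ) : Prop :=
  ∀ i, (σ i).2.IsDiag ∨ ∀ z ∈ (σ i).2, z ∈ h i

/-- The number of pairs connected in some color, counted with colors. -/
noncomputable def connCount (σ : I → Fin m × Sym2 τ) : ℕ :=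
  {t : Fin m × τ × τ | Conn σ Set.univ t.1 t.2.1 t.2.2}.ncard

/-- A valid choice of colors and pairs connecting as much as possible. -/
def Optimal (h : I → Set τ) (σ : I → Fin m × Sym2 τ) : Prop :=
  Valid h σ ∧ ∀ σ' : I → Fin m × Sym2 τ, Valid h σ' → connCount σ' ≤ connCount σ

open Classical in
/-- `σ'` arises from `σ` by giving a redundant edge a new color and a new pair. -/
def Move (h : I → Set τ) (σ σ' : I → Fin m × Sym2 τ) : Prop :=
  ∃ i j x y, Redundant σ i ∧ x ∈ h i ∧ y ∈ h i ∧ σ' = Function.update σ i (j, s(x, y))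

lemma exists_optimal [Finite τ] [Nonempty τ] [Finite I] (hm : 0 < m) (h : I → Set τ) :
    ∃ σ : I → Fin m × Sym2 τ, Optimal h σ := by
  obtain ⟨t⟩ := ‹Nonempty τ›
  obtain ⟨σ, hσ, hmax⟩ := Set.exists_max_image {σ : I → Fin m × Sym2 τ | Valid h σ} connCount
    (Set.toFinite _) ⟨fun _ => (⟨0, hm⟩, s(t, t)), fun i => .inl rfl⟩
  exact ⟨σ, hσ, hmax⟩

lemma Redundant.connSet_subset {σ : I → Fin m × Sym2 τ} {i : I} (hr : Redundant σ i)
    {σ' : I → Fin m × Sym2 τ} (hσ : ∀ i' ≠ i, σ i' = σ' i') :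
    {t : Fin m × τ × τ | Conn σ Set.univ t.1 t.2.1 t.2.2} ⊆
      {t : Fin m × τ × τ | Conn σ' Set.univ t.1 t.2.1 t.2.2} :=
  fun _ ht => ((hr.conn ht).congr hσ).mono (Set.subset_univ _)

lemma Move.optimal [Finite τ] {h : I → Set τ} {σ σ' : I → Fin m × Sym2 τ}
    (ho : Optimal h σ) (hmv : Move h σ σ') : Optimal h σ' := by
  classical
  obtain ⟨i, j, x, y, hr, hx, hy, rfl⟩ := hmv
  refine ⟨fun l => ?_, fun σ' hσ' => (ho.2 σ' hσ').trans (Set.ncard_le_ncard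
    (hr.connSet_subset fun l hl => by simp [hl]))⟩
  by_cases hl : l = i
  · subst hl
    right
    simp [hx, hy]
  · simpa [hl] using ho.1 l

/-- The hyperedges that become redundant after a sequence of moves. -/
def exchangeable (h : I → Set τ) (σ : I → Fin m × Sym2 τ) : Set I :=
  {i | ∃ σ', Relation.ReflTransGen (Move h) σ σ' ∧ Redundant σ' i}

lemma Redundant.conn_exchangeable [Finite τ] [Finite I] {h : I → Set τ}
    {σ₀ σ : I → Fin m × Sym2 τ}
    (ho : Optimal h σ) (hreach : Relation.ReflTransGen (Move h) σ₀ σ) {i : I}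
    (hr : Redundant σ i) {x y : τ} (hx : x ∈ h i) (hy : y ∈ h i) (j : Fin m) :
    Conn σ (exchangeable h σ₀) j x y := by
  classical
  set σ' := Function.update σ i (j, s(x, y)) with hσ'
  have hne : ∀ i' ≠ i, σ i' = σ' i' := fun i' hi' => by simp [hσ', hi']
  have hmv : Move h σ σ' := ⟨i, j, x, y, hr, hx, hy, rfl⟩
  have hconn : Conn σ {i}ᶜ j x y := by
    have heq := Set.eq_of_subset_of_ncard_le (hr.connSet_subset hne)
      (ho.2 _ (hmv.optimal ho).1)
    have : (j, x, y) ∈ {t : Fin m × τ × τ | Conn σ' Set.univ t.1 t.2.1 t.2.2} :=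
      Reaches.of_edge (e := i) ⟨trivial, by simp [hσ']⟩ (by simp [hσ'])
    rw [← heq] at this
    exact hr.conn this
  obtain ⟨D, ⟨hDi, hD⟩, hmin⟩ := Set.exists_min_image
    {D : Set I | D ⊆ {i}ᶜ ∧ Conn σ D j x y} Set.ncard (Set.toFinite _) ⟨_, subset_rfl, hconn⟩
  refine hD.mono fun d hd => ⟨σ', hreach.tail hmv, ?_⟩
  have hdi : d ≠ i := hDi hd
  have hnot : ¬ Conn σ (D \ {d}) j x y := fun h' =>
    (Set.ncard_sdiff_singleton_lt_of_mem hd).not_ge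
      (hmin _ ⟨Set.sdiff_subset.trans hDi, h'⟩)
  have hcd : (σ d).1 = j := by
    by_contra hcd
    exact hnot (Reaches.mono (fun e he => ⟨⟨he.1, by rintro rfl; exact hcd he.2⟩, he.2⟩) hD)
  intro a b hab
  rw [← hne d hdi] at hab ⊢
  rw [hcd]
  have hxy : Conn σ' {d}ᶜ j x y :=
    Reaches.of_edge (e := i) ⟨hdi.symm, by simp [hσ']⟩ (by simp [hσ'])
  have hsub : ∀ {u w}, Conn σ (D \ {d}) j u w → Conn σ' {d}ᶜ j u w := fun h' =>
    (h'.congr fun i' hi' => hne i' (hDi hi'.1)).mono fun _ hi' => hi'.2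
  have hD' : Reaches (fun i => (σ i).2) (insert d {i ∈ D \ {d} | (σ i).1 = j}) x y :=
    Reaches.mono (fun e he => (em (e = d)).imp id fun hed => ⟨⟨he.1, hed⟩, he.2⟩) hD
  obtain h' | ⟨h1, h2⟩ | ⟨h1, h2⟩ := hD'.of_insert hab
  · exact absurd h' hnot
  · exact ((hsub h1).symm.trans hxy).trans (hsub h2).symm
  · exact ((hsub h2).trans hxy.symm).trans (hsub h1)

lemma conn_exchangeable_of_reach [Finite τ] [Finite I] {h : I → Set τ}
    {σ₀ σ : I → Fin m × Sym2 τ}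
    (ho : Optimal h σ₀) (hreach : Relation.ReflTransGen (Move h) σ₀ σ) :
    Optimal h σ ∧ ∀ j a b, Conn σ (exchangeable h σ₀) j a b →
      Conn σ₀ (exchangeable h σ₀) j a b := by
  classical
  induction hreach with
  | refl => exact ⟨ho, fun _ _ _ => id⟩
  | @tail σ σ' hreach hmv ih =>
    refine ⟨hmv.optimal ih.1, fun j a b hc => ih.2 j a b ?_⟩
    obtain ⟨i, j', x, y, hr, hx, hy, rfl⟩ := hmv
    refine Reaches.lift id ?_ hc
    rintro i' ⟨hi', hj⟩ a b hab
    by_cases hi : i' = i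
    · subst hi
      simp only [Function.update_self] at hab hj
      subst hj
      have h1 := hr.conn_exchangeable ih.1 hreach hx hy j'
      rw [Sym2.eq_iff] at hab
      obtain ⟨rfl, rfl⟩ | ⟨rfl, rfl⟩ := hab
      · exact h1
      · exact h1.symm
    · simp only [Function.update_of_ne hi] at hab hj
      exact .of_edge ⟨hi', hj⟩ hab

lemma Optimal.conn_of_mem [Finite τ] [Finite I] {h : I → Set τ} {σ : I → Fin m × Sym2 τ}
    (ho : Optimal h σ) {i : I} (hi : i ∈ exchangeable h σ) {x y : τ} (hx : x ∈ h i)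
    (hy : y ∈ h i) (j : Fin m) : Conn σ (exchangeable h σ) j x y := by
  obtain ⟨σ', hreach, hr⟩ := hi
  have h1 := conn_exchangeable_of_reach ho hreach
  exact h1.2 _ _ _ (hr.conn_exchangeable h1.1 hreach hx hy j)

/-- The hyperedges meeting both `X` and its complement. -/
def hcut (h : I → Set τ) (X : Set τ) : Set I := {i | (h i ∩ X).Nonempty ∧ (h i \ X).Nonempty}

lemma Reaches.of_eqvGen {ends : E → Sym2 V} {F : Set E} {r : V → V → Prop}
    (hr : ∀ a b, r a b → Reaches ends F a b) {a b : V} (h : Relation.EqvGen r a b) :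
    Reaches ends F a b := by
  induction h with
  | rel a b h => exact hr a b h
  | refl => exact .refl _
  | symm _ _ _ ih => exact ih.symm
  | trans _ _ _ _ _ ih ih' => exact ih.trans ih'

open Classical in
/-- Double counting of the hyperedges leaving the classes of a partition. -/
lemma card_mul_le_of_hcut [Finite τ] [Finite I] {C : Type} [Finite C] (κ : τ → C) {h : I → Set τ}
    (hcard : ∀ i, (h i).ncard ≤ 3) {d : ℕ} (hd : ∀ u, d ≤ (hcut h (κ ⁻¹' {u})).ncard) :
    d * Nat.card C ≤ 3 * {i | ∃ a ∈ h i, ∃ b ∈ h i, κ a ≠ κ b}.ncard := by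
  have := Fintype.ofFinite C
  have := Fintype.ofFinite I
  calc d * Nat.card C = ∑ u : C, d := by simp [mul_comm]
    _ ≤ ∑ u : C, (hcut h (κ ⁻¹' {u})).ncard := Finset.sum_le_sum fun u _ => hd u
    _ = ∑ u : C, ∑ i : I, if i ∈ hcut h (κ ⁻¹' {u}) then 1 else 0 := by
        refine Finset.sum_congr rfl fun u _ => ?_
        rw [Set.ncard_eq_toFinset_card', Finset.sum_boole]
        simp [Set.toFinset]
    _ = ∑ i : I, ∑ u : C, if i ∈ hcut h (κ ⁻¹' {u}) then 1 else 0 := Finset.sum_comm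
    _ ≤ ∑ i : I, if i ∈ {i | ∃ a ∈ h i, ∃ b ∈ h i, κ a ≠ κ b} then 3 else 0 := by
        refine Finset.sum_le_sum fun i _ => ?_
        split_ifs with hi
        · rw [Finset.sum_boole, ← Set.ncard_coe_finset]
          refine (Nat.cast_id _).trans_le (le_trans (Set.ncard_le_ncard (t := κ '' h i) ?_)
            ((Set.ncard_image_le (Set.toFinite _)).trans (hcard i)))
          intro u hu
          simp only [Finset.coe_filter, Finset.mem_univ, true_and, Set.mem_ofPred_eq] at hu
          obtain ⟨⟨a, ha, hau⟩, -⟩ := hu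
          exact ⟨a, ha, hau⟩
        · refine (Finset.sum_eq_zero fun u _ => if_neg ?_).le
          rintro ⟨⟨a, ha, hau⟩, ⟨b, hb, hbu⟩⟩
          exact hi ⟨a, ha, b, hb, fun hab => hbu (hab.symm.trans hau)⟩
    _ = _ := by
        rw [← Finset.sum_filter, Finset.sum_const, smul_eq_mul, mul_comm, ← Set.ncard_coe_finset]
        simp

/-- A hypergraph with hyperedges of size at most three all of whose cuts have size at least `3m`
decomposes into `m` connected spanning subhypergraphs. -/
theorem exists_coloring [Finite τ] [Finite I] (hm : 0 < m) (h : I → Set τ)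
    (hcard : ∀ i, (h i).ncard ≤ 3)
    (hcuts : ∀ X : Set τ, X.Nonempty → Xᶜ.Nonempty → 3 * m ≤ (hcut h X).ncard) :
    ∃ c : I → Fin m, ∀ j a b,
      Relation.ReflTransGen (fun a b => ∃ i, c i = j ∧ a ∈ h i ∧ b ∈ h i) a b := by
  classical
  cases isEmpty_or_nonempty τ with
  | inl hτ => exact ⟨fun _ => ⟨0, hm⟩, fun _ a => hτ.elim a⟩
  | inr hτ =>
  obtain ⟨σ, ho⟩ := exists_optimal hm h
  set Y := exchangeable h σ with hY
  set r : τ → τ → Prop := fun a b => ∃ i ∈ Y, a ∈ h i ∧ b ∈ h i with hr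
  have hrc : ∀ j a b, r a b → Conn σ Y j a b := fun j a b ⟨i, hi, ha, hb⟩ =>
    ho.conn_of_mem hi ha hb j
  by_cases hC : Subsingleton (Quot r)
  · refine ⟨fun i => (σ i).1, fun j a b => ?_⟩
    have h1 : Conn σ Y j a b := Reaches.of_eqvGen (hrc j)
      (Quot.eqvGen_exact (Subsingleton.elim (Quot.mk r a) (Quot.mk r b)))
    induction h1 with
    | refl => exact .refl
    | @tail u w _ hs ih =>
      obtain ⟨i, ⟨-, hi⟩, huw⟩ := hs
      obtain hd | hv := ho.1 i
      · have : u = w := by simpa [huw] using hd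
        exact this ▸ ih
      · exact ih.tail ⟨i, hi, hv u (by simp [huw]), hv w (by simp [huw])⟩
  exfalso
  rw [not_subsingleton_iff_nontrivial] at hC
  choose p q hpq using exists_ends fun i => (σ i).2
  set Cr : Set I := {i | ∃ a ∈ h i, ∃ b ∈ h i, Quot.mk r a ≠ Quot.mk r b} with hCr
  have hcount : 3 * m * Nat.card (Quot r) ≤ 3 * Cr.ncard := by
    refine card_mul_le_of_hcut (Quot.mk r) hcard fun u => hcuts _ ?_ ?_
    · obtain ⟨a, rfl⟩ := Quot.exists_rep u
      exact ⟨a, rfl⟩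
    · obtain ⟨u', hu'⟩ := exists_ne u
      obtain ⟨a, rfl⟩ := Quot.exists_rep u'
      exact ⟨a, hu'⟩
  have hCrY : ∀ i ∈ Cr, i ∉ Y := fun i ⟨a, ha, b, hb, hab⟩ hi =>
    hab (Quot.sound ⟨i, hi, ha, hb⟩)
  have hcol : ∀ j, {i ∈ Cr | (σ i).1 = j}.ncard + 1 ≤ Nat.card (Quot r) := by
    intro j
    have : Nonempty (Quot fun a b => r a b ∨ ∃ i ∈ {i ∈ Cr | (σ i).1 = j}, a = p i ∧ b = q i) :=
      hτ.map (Quot.mk _)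
    refine le_trans (Nat.add_le_add_left Nat.card_pos _)
      (ncard_add_card_quot_le r p q {i ∈ Cr | (σ i).1 = j} ?_)
    rintro i ⟨hi, hij⟩ hgen
    have h1 : Conn σ {i}ᶜ j (p i) (q i) := by
      refine Reaches.of_eqvGen ?_ hgen
      rintro a b (hab | ⟨i', ⟨⟨-, hi'⟩, hne⟩, rfl, rfl⟩)
      · refine (hrc j a b hab).mono fun i' hi' => ?_
        rintro rfl
        exact hCrY _ hi hi'
      · exact .of_edge ⟨hne, hi'⟩ (hpq i')
    refine hCrY i hi ⟨σ, .refl, fun a b hab => ?_⟩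
    rw [hpq i, Sym2.eq_iff] at hab
    rw [hij]
    obtain ⟨rfl, rfl⟩ | ⟨rfl, rfl⟩ := hab
    · exact h1
    · exact Reaches.symm h1
  have hsum : Cr.ncard ≤ ∑ j, {i ∈ Cr | (σ i).1 = j}.ncard := by
    have : Cr = ⋃ j ∈ (Finset.univ : Finset (Fin m)), {i ∈ Cr | (σ i).1 = j} := by
      ext i; simp
    calc Cr.ncard = (⋃ j ∈ (Finset.univ : Finset (Fin m)), {i ∈ Cr | (σ i).1 = j}).ncard := by
          rw [← this]
      _ ≤ _ := Finset.set_ncard_biUnion_le _ _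
  have hle : Cr.ncard + m ≤ m * Nat.card (Quot r) := by
    calc Cr.ncard + m ≤ ∑ j : Fin m, ({i ∈ Cr | (σ i).1 = j}.ncard + 1) := by
          rw [Finset.sum_add_distrib]; simpa using hsum
      _ ≤ ∑ j : Fin m, Nat.card (Quot r) := Finset.sum_le_sum fun j _ => hcol j
      _ = _ := by simp
  nlinarith

end HypergraphPacking

section Splitting

open Classical in
lemma ncard_eq_sum_ite [Fintype E] (A : Set E) : A.ncard = ∑ e, if e ∈ A then 1 else 0 := by
  rw [Finset.sum_boole, ← Set.ncard_coe_finset]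
  simp

lemma ncard_cut_diff_add_le [Finite E] (ends : E → Sym2 V) {x : V} {X Y : Set V}
    (hX : x ∉ X) (hY : x ∉ Y) :
    (cut ends (X \ Y)).ncard + (cut ends (Y \ X)).ncard +
      2 * ((cut ends {x} ∩ cut ends X) ∩ (cut ends {x} ∩ cut ends Y)).ncard ≤
      (cut ends X).ncard + (cut ends Y).ncard := by
  classical
  have := Fintype.ofFinite E
  simp only [ncard_eq_sum_ite, Finset.mul_sum, ← Finset.sum_add_distrib]
  refine Finset.sum_le_sum fun e _ => ?_
  obtain ⟨a, b, h⟩ := exists_ends ends e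
  simp only [Set.mem_inter_iff, mem_cut_iff h, Set.mem_sdiff, Set.mem_singleton_iff]
  by_cases h1 : a = x <;> by_cases h2 : b = x <;> by_cases h3 : a ∈ X <;> by_cases h4 : b ∈ X <;>
    by_cases h5 : a ∈ Y <;> by_cases h6 : b ∈ Y <;> simp_all

lemma ncard_cut_three_le [Finite E] (ends : E → Sym2 V) {x : V} {X Y Z : Set V} :
    (cut ends (X ∩ Y ∩ Z)).ncard + (cut ends (X \ (Y ∪ Z))).ncard +
      (cut ends (Y \ (X ∪ Z))).ncard + (cut ends (Z \ (X ∪ Y))).ncard +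
      2 * (cut ends {x} ∩ cut ends X ∩ cut ends Y ∩ cut ends Z).ncard ≤
      (cut ends X).ncard + (cut ends Y).ncard + (cut ends Z).ncard := by
  classical
  have := Fintype.ofFinite E
  simp only [ncard_eq_sum_ite, Finset.mul_sum, ← Finset.sum_add_distrib]
  refine Finset.sum_le_sum fun e _ => ?_
  obtain ⟨a, b, h⟩ := exists_ends ends e
  simp only [Set.mem_inter_iff, mem_cut_iff h, Set.mem_sdiff, Set.mem_singleton_iff, Set.mem_union]
  by_cases h3 : a ∈ X <;> by_cases h4 : b ∈ X <;>
    by_cases h5 : a ∈ Y <;> by_cases h6 : b ∈ Y <;> by_cases h7 : a ∈ Z <;> by_cases h8 : b ∈ Z <;>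
    simp [h3, h4, h5, h6, h7, h8] <;> split_ifs <;> simp_all

lemma ncard_cut_insert_add_le [Finite E] (ends : E → Sym2 V) {x : V} {X : Set V} (hX : x ∉ X) :
    (cut ends (insert x X)).ncard + 2 * (cut ends {x} ∩ cut ends X).ncard ≤
      (cut ends X).ncard + (cut ends {x}).ncard := by
  classical
  have := Fintype.ofFinite E
  simp only [ncard_eq_sum_ite, Finset.mul_sum, ← Finset.sum_add_distrib]
  refine Finset.sum_le_sum fun e _ => ?_
  obtain ⟨a, b, h⟩ := exists_ends ends e
  simp only [Set.mem_inter_iff, mem_cut_iff h, Set.mem_insert_iff, Set.mem_singleton_iff]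
  by_cases h1 : a = x <;> by_cases h2 : b = x <;> by_cases h3 : a ∈ X <;> by_cases h4 : b ∈ X <;>
    simp_all

/-- The combinatorial core of the splitting argument: a family of sets of edges at a vertex in
which every pair of edges is covered cannot uncross in the way dangerous sets do. -/
lemma false_of_covering [Finite E] {N : Set E} (hN : 4 ≤ N.ncard) (D Tt : Set E → Prop)
    (hsub : ∀ A, D A → A ⊆ N) (hne : ∀ A, D A → A ≠ N)
    (hpair : ∀ e ∈ N, ∀ f ∈ N, e ≠ f → ∃ A, D A ∧ e ∈ A ∧ f ∈ A)
    (hcross : ∀ A B, D A → D B → (A ∩ B).Nonempty → ¬ A ⊆ B → ¬ B ⊆ A →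
      (A ∩ B).ncard ≤ 1 ∧ Tt (A \ B))
    (htight : ∀ C Z, Tt C → D Z → (C ∩ Z).Nonempty → C ⊆ Z ∨ Z ⊆ C)
    (hthree : ∀ A B C, D A → D B → D C → (A ∩ B ∩ C).Nonempty → (A \ (B ∪ C)).Nonempty →
      (B \ (A ∪ C)).Nonempty → ¬ (C \ (A ∪ B)).Nonempty) : False := by
  obtain ⟨e, he, f, hf, hef⟩ : ∃ e ∈ N, ∃ f ∈ N, e ≠ f := by
    obtain ⟨e, f, he, hf, hef⟩ := (Set.one_lt_ncard_iff (s := N)).1 (by omega)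
    exact ⟨e, he, f, hf, hef⟩
  obtain ⟨A₀, hA₀, heA₀, -⟩ := hpair e he f hf hef
  obtain ⟨A, ⟨hA, heA⟩, hAmax⟩ := Set.exists_max_image {A | D A ∧ e ∈ A} Set.ncard
    (Set.toFinite _) ⟨A₀, hA₀, heA₀⟩
  have hmaxA : ∀ Z, D Z → A ⊆ Z → Z ⊆ A := fun Z hZ hAZ =>
    (Set.eq_of_subset_of_ncard_le hAZ (hAmax Z ⟨hZ, hAZ heA⟩)).ge
  obtain ⟨g, hgN, hgA⟩ : ∃ g ∈ N, g ∉ A := by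
    by_contra! h
    exact hne A hA ((hsub A hA).antisymm h)
  obtain ⟨B₀, hB₀, heB₀, hgB₀⟩ := hpair e he g hgN (by rintro rfl; exact hgA heA)
  obtain ⟨B, ⟨hB, heB, hBA⟩, hBmax⟩ := Set.exists_max_image {B | D B ∧ e ∈ B ∧ ¬ B ⊆ A} Set.ncard
    (Set.toFinite _) ⟨B₀, hB₀, heB₀, fun h => hgA (h hgB₀)⟩
  have hAB : ¬ A ⊆ B := fun h => hBA (hmaxA B hB h)
  have hone : ∀ {P Q : Set E}, (P ∩ Q).ncard ≤ 1 → ∀ {a b}, a ∈ P → a ∈ Q → b ∈ P → b ∈ Q →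
      a = b := fun h _ _ h1 h2 h3 h4 =>
    (Set.ncard_le_one (Set.toFinite _)).1 h _ ⟨h1, h2⟩ _ ⟨h3, h4⟩
  obtain ⟨hAB1, hC⟩ := hcross A B hA hB ⟨e, heA, heB⟩ hAB hBA
  obtain ⟨a, haA, haB⟩ := Set.not_subset.1 hAB
  obtain ⟨b, hbB, hbA⟩ := Set.not_subset.1 hBA
  have hcover : N ⊆ A ∪ B := by
    intro g hg
    by_contra hgAB
    simp only [Set.mem_union, not_or] at hgAB
    obtain ⟨Z, hZ, heZ, hgZ⟩ := hpair e he g hg (by rintro rfl; exact hgAB.1 heA)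
    have hZA : ¬ Z ⊆ A := fun h => hgAB.1 (h hgZ)
    have hZB : ¬ Z ⊆ B := fun h => hgAB.2 (h hgZ)
    have hAZ : ¬ A ⊆ Z := fun h => hZA (hmaxA Z hZ h)
    have hBZ : ¬ B ⊆ Z := fun h =>
      hZB (Set.eq_of_subset_of_ncard_le h (hBmax Z ⟨hZ, heZ, hZA⟩)).ge
    have hAZ1 := (hcross A Z hA hZ ⟨e, heA, heZ⟩ hAZ hZA).1
    have hBZ1 := (hcross B Z hB hZ ⟨e, heB, heZ⟩ hBZ hZB).1
    refine hthree A B Z hA hB hZ ⟨e, ⟨heA, heB⟩, heZ⟩ ⟨a, haA, ?_⟩ ⟨b, hbB, ?_⟩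
      ⟨g, hgZ, by simpa using hgAB⟩
    · rintro (h | h)
      · exact haB h
      · exact haB (hone hAZ1 haA h heA heZ ▸ heB)
    · rintro (h | h)
      · exact hbA h
      · exact hbA (hone hBZ1 hbB h heB heZ ▸ heA)
  have hcard : 2 ≤ (A \ B).ncard := by
    have h1 := Set.ncard_le_ncard hcover
    have h2 := Set.ncard_union_add_ncard_inter A B
    have h3 := Set.ncard_inter_add_ncard_sdiff_eq_ncard A B
    have h4 := hAmax B ⟨hB, heB⟩
    have h5 : 0 < (A ∩ B).ncard := (Set.ncard_pos).2 ⟨e, heA, heB⟩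
    omega
  have heC : ∀ Z, D Z → e ∈ Z → A \ B ⊆ Z → A ⊆ Z := fun Z _ heZ h c hc => by
    by_cases hcB : c ∈ B
    · exact hone hAB1 hc hcB heA heB ▸ heZ
    · exact h ⟨hc, hcB⟩
  have haN := hsub A hA haA
  obtain ⟨Z₁, hZ₁, haZ₁, heZ₁⟩ := hpair a haN e he (by rintro rfl; exact haB heB)
  obtain ⟨Z₂, hZ₂, haZ₂, hbZ₂⟩ := hpair a haN b (hsub B hB hbB) (by rintro rfl; exact haB hbB)
  have h1 : A \ B ⊆ Z₁ := (htight _ Z₁ hC hZ₁ ⟨a, ⟨haA, haB⟩, haZ₁⟩).resolve_right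
    fun h => (h heZ₁).2 heB
  have h2 : A \ B ⊆ Z₂ := (htight _ Z₂ hC hZ₂ ⟨a, ⟨haA, haB⟩, haZ₂⟩).resolve_right
    fun h => hbA (h hbZ₂).1
  have hAZ₁ := heC Z₁ hZ₁ heZ₁ h1
  have hle : Z₁ ⊆ Z₂ ∨ Z₂ ⊆ Z₁ := by
    by_contra! h
    have h3 := (hcross Z₁ Z₂ hZ₁ hZ₂ ⟨a, haZ₁, haZ₂⟩ h.1 h.2).1
    have h4 := Set.ncard_le_ncard (Set.subset_inter h1 h2)
    omega
  obtain h | h := hle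
  · exact hbA (hmaxA Z₂ hZ₂ (hAZ₁.trans h) hbZ₂)
  · exact hbA (hmaxA Z₁ hZ₁ hAZ₁ (h hbZ₂))

end Splitting

section Splitting

variable {ends : E → Sym2 V} {T : Set V} {l : ℕ}

/-- At a vertex `x ∉ T` of degree at least four all of whose neighbors are in `T`, some pair of
edges can be split off: no cut of size at most `l + 1` contains both of them. -/
lemma exists_splittable [Finite E] {x : V} (hl : 2 ≤ l)
    (hcuts : ∀ X : Set V, (X ∩ T).Nonempty → (T \ X).Nonempty → l ≤ (cut ends X).ncard)
    (hx : x ∉ T) (hN : 4 ≤ (cut ends {x}).ncard)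
    (hxT : ∀ e ∈ cut ends {x}, ∃ s ∈ T, ends e = s(x, s)) :
    ∃ f ∈ cut ends {x}, ∃ g ∈ cut ends {x}, f ≠ g ∧
      ∀ X : Set V, x ∉ X → (X ∩ T).Nonempty → (T \ X).Nonempty →
        f ∈ cut ends X → g ∈ cut ends X → l + 2 ≤ (cut ends X).ncard := by
  by_contra! hno
  set N := cut ends {x} with hNdef
  have hend : ∀ X : Set V, x ∉ X → ∀ e ∈ N ∩ cut ends X, ∃ s ∈ T, s ∈ X ∧ ends e = s(x, s) := by
    rintro X hX e ⟨he, heX⟩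
    obtain ⟨s, hs, h⟩ := hxT e he
    rw [mem_cut_iff h] at heX
    exact ⟨s, hs, by tauto, h⟩
  have hin : ∀ X : Set V, x ∉ X → ∀ e s, ends e = s(x, s) → e ∈ N → e ∉ N ∩ cut ends X → s ∉ X := by
    intro X hX e s h heN he hs
    exact he ⟨heN, (mem_cut_iff h).2 (by tauto)⟩
  let Dg : Set V → Prop := fun X => x ∉ X ∧ (X ∩ T).Nonempty ∧ (T \ X).Nonempty ∧
    (cut ends X).ncard ≤ l + 1
  have hsd : ∀ X Y : Set V, x ∉ X → x ∉ Y →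
      N ∩ cut ends (X \ Y) = (N ∩ cut ends X) \ (N ∩ cut ends Y) := by
    intro X Y hX hY
    ext e
    simp only [Set.mem_inter_iff, Set.mem_sdiff]
    by_cases he : e ∈ N
    · obtain ⟨s, -, h⟩ := hxT e he
      simp only [he, mem_cut_iff h, Set.mem_sdiff]
      tauto
    · tauto
  have hdiff : ∀ X Y : Set V, x ∉ X → x ∉ Y → ¬ N ∩ cut ends X ⊆ N ∩ cut ends Y →
      ¬ N ∩ cut ends Y ⊆ N ∩ cut ends X → l ≤ (cut ends (X \ Y)).ncard := by
    intro X Y hX hY h1 h2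
    obtain ⟨e, he, he'⟩ := Set.not_subset.1 h1
    obtain ⟨f, hf, hf'⟩ := Set.not_subset.1 h2
    obtain ⟨s, hs, hsX, h⟩ := hend X hX e he
    obtain ⟨t, ht, htY, -⟩ := hend Y hY f hf
    exact hcuts _ ⟨s, ⟨hsX, hin Y hY e s h he.1 he'⟩, hs⟩ ⟨t, ht, fun h => h.2 htY⟩
  refine false_of_covering hN (fun A => ∃ X, Dg X ∧ A = N ∩ cut ends X)
    (fun A => ∃ X, (x ∉ X ∧ (cut ends X).ncard ≤ l) ∧ A = N ∩ cut ends X) ?_ ?_ ?_ ?_ ?_ ?_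
  · rintro _ ⟨X, -, rfl⟩
    exact Set.inter_subset_left
  · rintro _ ⟨X, ⟨hX, ⟨s, hsX, hs⟩, ⟨t, ht, htX⟩, hd⟩, rfl⟩ h
    have h1 := ncard_cut_insert_add_le ends hX
    have h2 := hcuts (insert x X) ⟨s, .inr hsX, hs⟩
      ⟨t, ht, by rintro (rfl | h); exacts [hx ht, htX h]⟩
    rw [← hNdef, h] at h1
    omega
  · intro e he f hf hef
    obtain ⟨X, hX, h1, h2, h3, h4, h5⟩ := hno e he f hf hef
    exact ⟨_, ⟨X, ⟨hX, h1, h2, by omega⟩, rfl⟩, ⟨he, h3⟩, ⟨hf, h4⟩⟩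
  · rintro _ _ ⟨X, ⟨hX, -, -, hdX⟩, rfl⟩ ⟨Y, ⟨hY, -, -, hdY⟩, rfl⟩ hne h1 h2
    have h3 := hdiff X Y hX hY h1 h2
    have h4 := hdiff Y X hY hX h2 h1
    have h5 := ncard_cut_diff_add_le ends hX hY
    rw [← hNdef] at h5
    have h6 := (Set.ncard_pos (Set.toFinite _)).2 hne
    exact ⟨by omega, X \ Y, ⟨fun h => hX h.1, by omega⟩, (hsd X Y hX hY).symm⟩
  · rintro _ _ ⟨X, ⟨hX, hdX⟩, rfl⟩ ⟨Y, ⟨hY, -, -, hdY⟩, rfl⟩ hne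
    by_contra! h
    have h3 := hdiff X Y hX hY h.1 h.2
    have h4 := hdiff Y X hY hX h.2 h.1
    have h5 := ncard_cut_diff_add_le ends hX hY
    rw [← hNdef] at h5
    have h6 := (Set.ncard_pos (Set.toFinite _)).2 hne
    omega
  · rintro _ _ _ ⟨X, ⟨hX, -, hX', hdX⟩, rfl⟩ ⟨Y, ⟨hY, -, -, hdY⟩, rfl⟩ ⟨Z, ⟨hZ, -, -, hdZ⟩, rfl⟩
      ⟨e, ⟨heX, heY⟩, heZ⟩ ⟨a, haX, haYZ⟩ ⟨b, hbY, hbXZ⟩ ⟨c, hcZ, hcXY⟩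
    simp only [Set.mem_union, not_or] at haYZ hbXZ hcXY
    obtain ⟨s, hs, hsX, hse⟩ := hend X hX e heX
    obtain ⟨sa, hsa, haX', ha⟩ := hend X hX a haX
    obtain ⟨sb, hsb, hbY', hb⟩ := hend Y hY b hbY
    obtain ⟨sc, hsc, hcZ', hc⟩ := hend Z hZ c hcZ
    have h0 : 0 < (cut ends {x} ∩ cut ends X ∩ cut ends Y ∩ cut ends Z).ncard :=
      (Set.ncard_pos (Set.toFinite _)).2 ⟨e, ⟨heX, heY.2⟩, heZ.2⟩
    have hsY : s ∈ Y := by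
      have := heY.2
      rw [mem_cut_iff hse] at this
      tauto
    have hsZ : s ∈ Z := by
      have := heZ.2
      rw [mem_cut_iff hse] at this
      tauto
    have h1 := ncard_cut_three_le ends (x := x) (X := X) (Y := Y) (Z := Z)
    have h2 := hcuts (X ∩ Y ∩ Z) ⟨s, ⟨⟨hsX, hsY⟩, hsZ⟩, hs⟩ (hX'.mono fun t ht =>
      ⟨ht.1, fun h => ht.2 h.1.1⟩)
    have h3 := hcuts (X \ (Y ∪ Z)) ⟨sa, ⟨haX', by
      simpa using ⟨hin Y hY a sa ha haX.1 haYZ.1, hin Z hZ a sa ha haX.1 haYZ.2⟩⟩, hsa⟩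
      ⟨sb, hsb, fun h => h.2 (.inl hbY')⟩
    have h4 := hcuts (Y \ (X ∪ Z)) ⟨sb, ⟨hbY', by
      simpa using ⟨hin X hX b sb hb hbY.1 hbXZ.1, hin Z hZ b sb hb hbY.1 hbXZ.2⟩⟩, hsb⟩
      ⟨sa, hsa, fun h => h.2 (.inl haX')⟩
    have h5 := hcuts (Z \ (X ∪ Y)) ⟨sc, ⟨hcZ', by
      simpa using ⟨hin X hX c sc hc hcZ.1 hcXY.1, hin Y hY c sc hc hcZ.1 hcXY.2⟩⟩, hsc⟩
      ⟨sa, hsa, fun h => h.2 (.inl haX')⟩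
    omega

open Classical in
/-- Splitting off the pair `f = xs`, `g = xt`: the edge `f` is replaced by an edge `st` and `g` by
a loop at `x`. -/
noncomputable def splitOff (ends : E → Sym2 V) (f g : E) (x s t : V) : E → Sym2 V :=
  Function.update (Function.update ends f s(s, t)) g s(x, x)

lemma le_ncard_cut_splitOff [Finite E] {f g : E} {x s t : V} (hfg : f ≠ g) (hf : ends f = s(x, s))
    (hg : ends g = s(x, t))
    (hcuts : ∀ X : Set V, (X ∩ T).Nonempty → (T \ X).Nonempty → l ≤ (cut ends X).ncard)
    (hsplit : ∀ X : Set V, x ∉ X → (X ∩ T).Nonempty → (T \ X).Nonempty →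
        f ∈ cut ends X → g ∈ cut ends X → l + 2 ≤ (cut ends X).ncard)
    (X : Set V) (h1 : (X ∩ T).Nonempty) (h2 : (T \ X).Nonempty) :
    l ≤ (cut (splitOff ends f g x s t) X).ncard := by
  classical
  wlog hxX : x ∉ X generalizing X
  · rw [← cut_compl]
    refine this Xᶜ ?_ ?_ (by simpa using hxX)
    · obtain ⟨a, ha, ha'⟩ := h2
      exact ⟨a, ha', ha⟩
    · obtain ⟨a, ha, ha'⟩ := h1
      exact ⟨a, ha', fun h => h ha⟩
  have hf' : splitOff ends f g x s t f = s(s, t) := by simp [splitOff, hfg]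
  have hg' : splitOff ends f g x s t g = s(x, x) := by simp [splitOff]
  have hother : ∀ e, e ≠ f → e ≠ g → (e ∈ cut (splitOff ends f g x s t) X ↔ e ∈ cut ends X) := by
    intro e he he'
    simp [splitOff, cut, he, he']
  have hfc := mem_cut_iff (X := X) hf
  have hgc := mem_cut_iff (X := X) hg
  have hfc' := mem_cut_iff (X := X) hf'
  simp only [hxX, false_iff, not_not] at hfc hgc
  by_cases hst : s ∈ X ∧ t ∈ X
  · have h3 := hsplit X hxX h1 h2 (hfc.2 hst.1) (hgc.2 hst.2)
    have h4 : cut ends X ⊆ insert f (insert g (cut (splitOff ends f g x s t) X)) := by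
      intro e he
      by_cases he1 : e = f
      · exact .inl he1
      by_cases he2 : e = g
      · exact .inr (.inl he2)
      exact .inr (.inr ((hother e he1 he2).2 he))
    have h5 := Set.ncard_le_ncard h4
    have h6 := Set.ncard_insert_le f (insert g (cut (splitOff ends f g x s t) X))
    have h7 := Set.ncard_insert_le g (cut (splitOff ends f g x s t) X)
    omega
  · refine (hcuts X h1 h2).trans (Set.ncard_le_ncard_of_injOn
      (fun e => if e = g then f else e) ?_ ?_)
    · intro e he
      split_ifs with he2
      · have ht := hgc.1 (he2 ▸ he)
        exact hfc'.2 fun h => hst ⟨h.2 ht, ht⟩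
      · by_cases he1 : e = f
        · have hs := hfc.1 (he1 ▸ he)
          rw [he1]
          exact hfc'.2 fun h => hst ⟨hs, h.1 hs⟩
        · exact (hother e he1 he2).2 he
    · have h8 : ¬ (f ∈ cut ends X ∧ g ∈ cut ends X) := fun h => hst ⟨hfc.1 h.1, hgc.1 h.2⟩
      intro e he e' he' h
      dsimp only at h
      split_ifs at h with h3 h4 h4
      · rw [h3, h4]
      · subst h h3
        exact absurd ⟨he', he⟩ h8
      · subst h h4
        exact absurd ⟨he, he'⟩ h8
      · exact h

/-- Undoing a splitting in a family of edge-disjoint connected subgraphs. -/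
lemma exists_family_of_splitOff {m : ℕ} {f g : E} {x s t : V} (hf : ends f = s(x, s))
    (hg : ends g = s(x, t)) {H : Fin m → Set E} (hH : PairwiseEdgeDisjoint H)
    (hc : ∀ j, ConnectsSet (splitOff ends f g x s t) (H j) T) :
    ∃ H : Fin m → Set E, PairwiseEdgeDisjoint H ∧ ∀ j, ConnectsSet ends (H j) T := by
  refine ⟨fun j => {e | (e ≠ g ∧ e ∈ H j) ∨ (e = g ∧ f ∈ H j)}, fun i j hij => ?_,
    fun j a ha b hb => Reaches.lift id ?_ (hc j a ha b hb)⟩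
  · rw [Set.disjoint_left]
    have h1 : ∀ e, e ∈ H i → e ∉ H j := fun e he => Set.disjoint_left.1 (hH i j hij) he
    rintro e (⟨h2, h3⟩ | ⟨h2, h3⟩) (⟨h4, h5⟩ | ⟨h4, h5⟩)
    · exact h1 _ h3 h5
    · exact h2 h4
    · exact h4 h2
    · exact h1 _ h3 h5
  · intro e he a b hab
    by_cases he1 : e = g
    · subst he1
      simp only [splitOff, Function.update_self, Sym2.eq_iff] at hab
      obtain ⟨rfl, rfl⟩ | ⟨rfl, rfl⟩ := hab <;> exact .refl _
    by_cases he2 : e = f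
    · subst he2
      have hst : Reaches ends {e' | (e' ≠ g ∧ e' ∈ H j) ∨ (e' = g ∧ e ∈ H j)} s t :=
        (Reaches.of_edge (.inl ⟨he1, he⟩) (hf.trans Sym2.eq_swap)).trans
          (.of_edge (.inr ⟨rfl, he⟩) hg)
      simp only [splitOff, Function.update_self, ne_eq, he1, not_false_eq_true,
        Function.update_of_ne, Sym2.eq_iff] at hab
      obtain ⟨rfl, rfl⟩ | ⟨rfl, rfl⟩ := hab
      · exact hst
      · exact hst.symm
    · refine .of_edge (.inl ⟨he1, he⟩) ?_
      simpa [splitOff, he1, he2] using hab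

open Classical in
/-- If the vertices outside of `T` are pairwise non-adjacent and have degree at most three, then
`3m`-edge-connectedness of `T` yields `m` edge-disjoint subgraphs connecting `T`. -/
lemma exists_family_of_ncard_cut_le [Finite V] [Finite E] {m : ℕ} (hm : 0 < m)
    (hst : ∀ e, ¬ (ends e).IsDiag → ∃ z ∈ ends e, z ∈ T)
    (hcuts : ∀ X : Set V, (X ∩ T).Nonempty → (T \ X).Nonempty → 3 * m ≤ (cut ends X).ncard)
    (hdeg : ∀ x ∉ T, (cut ends {x}).ncard ≤ 3) :
    ∃ H : Fin m → Set E, PairwiseEdgeDisjoint H ∧ ∀ j, ConnectsSet ends (H j) T := by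
  let h : E ⊕ V → Set T := Sum.elim (fun e => {t | ↑t ∈ ends e ∧ ∀ z ∈ ends e, z ∈ T})
    (fun x => {t | x ∉ T ∧ ∃ e, ends e = s(x, ↑t)})
  have hmem : ∀ {x t : V} {e : E}, x ∉ T → t ∈ T → ends e = s(x, t) → e ∈ cut ends {x} := by
    rintro x t e hx ht he
    rw [mem_cut_iff he]
    have : t ≠ x := by rintro rfl; exact hx ht
    simpa using this
  have hcard : ∀ i, (h i).ncard ≤ 3 := by
    rintro (e | x)
    · obtain ⟨a, b, hab⟩ := exists_ends ends e
      refine (Set.ncard_le_ncard_of_injOn (t := {a, b}) Subtype.val ?_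
        Subtype.val_injective.injOn).trans ((Set.ncard_insert_le _ _).trans (by simp))
      rintro t ⟨ht, -⟩
      simpa [hab] using ht
    · by_cases hne : h (.inr x) = ∅
      · simp [hne]
      · obtain ⟨t₀, hx, e₀, -⟩ := Set.nonempty_iff_ne_empty.2 hne
        have h1 : ∀ t : T, ∃ e, t ∈ h (.inr x) → ends e = s(x, ↑t) := fun t => by
          by_cases ht : t ∈ h (.inr x)
          · exact ht.2.imp fun e he _ => he
          · exact ⟨e₀, fun h => absurd h ht⟩
        choose φ hφ using h1
        refine (Set.ncard_le_ncard_of_injOn (t := cut ends {x}) φ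
          (fun t ht => hmem hx t.2 (hφ t ht)) ?_).trans (hdeg x hx)
        intro t ht t' ht' htt
        have h2 := (hφ t ht).symm.trans ((congrArg ends htt).trans (hφ t' ht'))
        simp only [Sym2.congr_right] at h2
        exact Subtype.ext h2
  let idx : E → E ⊕ V := fun e => if hx : ∃ x ∈ ends e, x ∉ T then .inr hx.choose else .inl e
  have hidx : ∀ {x t : V} {e : E}, x ∉ T → t ∈ T → ends e = s(x, t) → idx e = .inr x := by
    intro x t e hx ht he
    have h1 : ∃ x ∈ ends e, x ∉ T := ⟨x, by simp [he], hx⟩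
    obtain ⟨y, h2, h3, h4⟩ : ∃ y, idx e = .inr y ∧ y ∈ ends e ∧ y ∉ T :=
      ⟨h1.choose, dif_pos h1, h1.choose_spec⟩
    rw [he, Sym2.mem_iff] at h3
    obtain rfl | rfl := h3
    · exact h2
    · exact absurd ht h4
  have hidx' : ∀ {e : E}, (∀ z ∈ ends e, z ∈ T) → idx e = .inl e := by
    intro e he
    have h1 : ¬ ∃ x ∈ ends e, x ∉ T := by push Not; exact he
    simp only [idx, dif_neg h1]
  have hhcuts : ∀ X : Set T, X.Nonempty → Xᶜ.Nonempty → 3 * m ≤ (hcut h X).ncard := by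
    intro X hX hXc
    let A : V → Set E := fun x => {e | ∃ t ∈ X, ends e = s(x, ↑t)}
    let B : V → Set E := fun x => {e | ∃ t ∉ X, ends e = s(x, ↑t)}
    have hAB : ∀ x ∉ T, (A x).ncard + (B x).ncard ≤ 3 := by
      intro x hx
      rw [← Set.ncard_union_eq]
      · refine (Set.ncard_le_ncard ?_).trans (hdeg x hx)
        rintro e (⟨t, -, he⟩ | ⟨t, -, he⟩) <;> exact hmem hx t.2 he
      · rw [Set.disjoint_left]
        rintro e ⟨t, ht, he⟩ ⟨t', ht', he'⟩
        have h2 := he.symm.trans he'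
        simp only [Sym2.congr_right] at h2
        exact ht' (Subtype.ext h2 ▸ ht)
    let X' : Set V := {z | (∃ hz : z ∈ T, ⟨z, hz⟩ ∈ X) ∨ (z ∉ T ∧ (B z).ncard ≤ (A z).ncard)}
    have hX'T : ∀ t : T, (t : V) ∈ X' ↔ t ∈ X := fun t => by simp [X']
    have hX'U : ∀ x ∉ T, x ∈ X' ↔ (B x).ncard ≤ (A x).ncard := fun x hx => by simp [X', hx]
    have hform : ∀ e ∈ cut ends X', (∀ z ∈ ends e, z ∈ T) ∨
        ∃ x ∉ T, ∃ t : T, ends e = s(x, ↑t) ∧ ¬ (x ∈ X' ↔ t ∈ X) := by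
      intro e he
      by_cases h1 : ∀ z ∈ ends e, z ∈ T
      · exact .inl h1
      push Not at h1
      obtain ⟨x, hxe, hx⟩ := h1
      obtain ⟨y, hy⟩ := Sym2.mem_iff_exists.1 hxe
      have hxy : x ≠ y := by
        rintro rfl
        simp [mem_cut_iff hy] at he
      obtain ⟨z, hz, hzT⟩ := hst e (by simpa [hy] using hxy)
      rw [hy, Sym2.mem_iff] at hz
      obtain rfl | rfl := hz
      · exact absurd hzT hx
      · refine .inr ⟨x, hx, ⟨z, hzT⟩, hy, ?_⟩
        rwa [← hX'T, ← mem_cut_iff hy]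
    have hside : ∀ x ∉ T, ∀ e (t : T), ends e = s(x, ↑t) → ¬ (x ∈ X' ↔ t ∈ X) →
        (x ∈ X' ∧ e ∈ B x) ∨ (x ∉ X' ∧ e ∈ A x) := by
      intro x _ e t he hxt
      by_cases hxX : x ∈ X'
      · exact .inl ⟨hxX, t, by tauto, he⟩
      · exact .inr ⟨hxX, t, by tauto, he⟩
    refine (hcuts X' ?_ ?_).trans (Set.ncard_le_ncard_of_injOn idx ?_ ?_)
    · obtain ⟨t, ht⟩ := hX
      exact ⟨t, (hX'T t).2 ht, t.2⟩
    · obtain ⟨t, ht⟩ := hXc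
      exact ⟨t, t.2, fun h => ht ((hX'T t).1 h)⟩
    · intro e he
      obtain hT | ⟨x, hx, t, hxt, hcr⟩ := hform e he
      · obtain ⟨⟨a, ha, haX⟩, ⟨b, hb, hbX⟩⟩ := he
        rw [hidx' hT]
        exact ⟨⟨⟨a, hT a ha⟩, ⟨ha, hT⟩, (hX'T ⟨a, hT a ha⟩).1 haX⟩,
          ⟨⟨b, hT b hb⟩, ⟨hb, hT⟩, fun h => hbX ((hX'T ⟨b, hT b hb⟩).2 h)⟩⟩
      · rw [hidx hx t.2 hxt]
        have h1 := hX'U x hx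
        have h2 : (A x).Nonempty ∧ (B x).Nonempty := by
          simp only [← Set.ncard_pos (Set.toFinite _)]
          obtain ⟨h3, h4⟩ | ⟨h3, h4⟩ := hside x hx e t hxt hcr
          · have h5 := (Set.ncard_pos (Set.toFinite _)).2 ⟨e, h4⟩
            have := h1.1 h3
            omega
          · have h5 := (Set.ncard_pos (Set.toFinite _)).2 ⟨e, h4⟩
            rw [h1] at h3
            omega
        obtain ⟨⟨e₁, t₁, ht₁, he₁⟩, ⟨e₂, t₂, ht₂, he₂⟩⟩ := h2
        exact ⟨⟨t₁, ⟨hx, e₁, he₁⟩, ht₁⟩, ⟨t₂, ⟨hx, e₂, he₂⟩, ht₂⟩⟩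
    · intro e he e' he' hee
      obtain hT | ⟨x, hx, t, hxt, hcr⟩ := hform e he <;>
        obtain hT' | ⟨x', hx', t', hxt', hcr'⟩ := hform e' he'
      · rw [hidx' hT, hidx' hT'] at hee
        simpa using hee
      · rw [hidx' hT, hidx hx' t'.2 hxt'] at hee
        simp at hee
      · rw [hidx' hT', hidx hx t.2 hxt] at hee
        simp at hee
      · rw [hidx hx' t'.2 hxt', hidx hx t.2 hxt, Sum.inr.injEq] at hee
        subst hee
        have h1 := hX'U x hx
        have h2 := hAB x hx
        obtain ⟨h3, h4⟩ | ⟨h3, h4⟩ := hside x hx e t hxt hcr <;>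
          obtain ⟨h5, h6⟩ | ⟨h5, h6⟩ := hside x hx e' t' hxt' hcr'
        · have := h1.1 h3
          exact (Set.ncard_le_one (Set.toFinite _)).1 (by omega) _ h4 _ h6
        · exact absurd h3 h5
        · exact absurd h5 h3
        · rw [h1] at h3
          exact (Set.ncard_le_one (Set.toFinite _)).1 (by omega) _ h4 _ h6
  obtain ⟨c, hc⟩ := exists_coloring hm h hcard hhcuts
  refine ⟨fun j => {e | c (idx e) = j}, fun i j hij => ?_, fun j a ha b hb => ?_⟩
  · rw [Set.disjoint_left]
    rintro e rfl h
    exact hij h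
  · have h1 := hc j ⟨a, ha⟩ ⟨b, hb⟩
    generalize hb' : (⟨b, hb⟩ : T) = b' at h1
    have : b = b' := by rw [← hb']
    rw [this]
    clear hb' this
    induction h1 with
    | refl => exact .refl _
    | @tail u w _ hs ih =>
      refine ih.trans ?_
      obtain ⟨e | x, hi, hu, hw⟩ := hs
      · obtain ⟨p, q, hpq⟩ := exists_ends ends e
        have he : e ∈ {e | c (idx e) = j} := by
          simpa [hidx' hu.2] using hi
        have h1 := hu.1
        have h2 := hw.1
        simp only [hpq, Sym2.mem_iff] at h1 h2
        have h3 := Reaches.of_edge he hpq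
        obtain h1 | h1 := h1 <;> obtain h2 | h2 := h2 <;> rw [h1, h2]
        · exact .refl _
        · exact h3
        · exact h3.symm
        · exact .refl _
      · obtain ⟨hx, e, he⟩ := hu
        obtain ⟨-, e', he'⟩ := hw
        refine (Reaches.of_edge (e := e) ?_ (he.trans Sym2.eq_swap)).trans
          (.of_edge (e := e') ?_ he')
        · simpa [hidx hx u.2 he] using hi
        · simpa [hidx hx w.2 he'] using hi

/-- If the vertices outside of `T` are pairwise non-adjacent, then
`3m`-edge-connectedness of `T` yields `m` edge-disjoint subgraphs connecting `T`. -/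
theorem exists_connecting_family [Finite V] [Finite E] {m : ℕ} (ends : E → Sym2 V) {T : Set V}
    (hst : ∀ e, ¬ (ends e).IsDiag → ∃ z ∈ ends e, z ∈ T)
    (hcuts : ∀ X : Set V, (X ∩ T).Nonempty → (T \ X).Nonempty → 3 * m ≤ (cut ends X).ncard) :
    ∃ H : Fin m → Set E, PairwiseEdgeDisjoint H ∧ ∀ j, ConnectsSet ends (H j) T := by
  obtain rfl | hm := Nat.eq_zero_or_pos m
  · exact ⟨fun _ => ∅, fun i => i.elim0, fun i => i.elim0⟩
  induction hn : {e | ¬ (ends e).IsDiag}.ncard using Nat.strong_induction_on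
    generalizing ends with
  | _ n ih =>
  by_cases hdeg : ∀ x ∉ T, (cut ends {x}).ncard ≤ 3
  · exact exists_family_of_ncard_cut_le hm hst hcuts hdeg
  push Not at hdeg
  obtain ⟨x, hx, hN⟩ := hdeg
  have hxT : ∀ e ∈ cut ends {x}, ∃ s ∈ T, ends e = s(x, s) := by
    intro e he
    obtain ⟨a, b, hab⟩ := exists_ends ends e
    rw [mem_cut_iff hab] at he
    simp only [Set.mem_singleton_iff] at he
    obtain ⟨z, hz, hzT⟩ := hst e (by rw [hab, Sym2.mk_isDiag_iff]; rintro rfl; tauto)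
    have hzx : z ≠ x := by rintro rfl; exact hx hzT
    rw [hab, Sym2.mem_iff] at hz
    by_cases ha : a = x
    · subst ha
      obtain rfl | rfl := hz
      · exact absurd rfl hzx
      · exact ⟨z, hzT, hab⟩
    · have hb : b = x := by tauto
      subst hb
      obtain rfl | rfl := hz
      · exact ⟨z, hzT, hab.trans Sym2.eq_swap⟩
      · exact absurd rfl hzx
  obtain ⟨f, hfN, g, hgN, hfg, hsplit⟩ := exists_splittable (by omega) hcuts hx hN hxT
  obtain ⟨s, hs, hf⟩ := hxT f hfN
  obtain ⟨t, ht, hg⟩ := hxT g hgN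
  obtain ⟨H, hH, hHc⟩ := ih {e | ¬ (splitOff ends f g x s t e).IsDiag}.ncard (by
    rw [← hn]
    refine Set.ncard_lt_ncard ⟨?_, ?_⟩
    · intro e he
      by_cases he1 : e = g
      · simp [splitOff, he1] at he
      by_cases he2 : e = f
      · have : x ≠ s := by rintro rfl; exact hx hs
        simpa [he2, hf] using this
      · simpa [splitOff, he1, he2] using he
    · intro h
      have hxt : x ≠ t := by rintro rfl; exact hx ht
      have := h (show g ∈ {e | ¬ (ends e).IsDiag} by simpa [hg] using hxt)
      simp [splitOff] at this) (splitOff ends f g x s t) (by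
    intro e he
    by_cases he1 : e = g
    · simp [splitOff, he1] at he
    by_cases he2 : e = f
    · exact ⟨s, by simp [splitOff, he2, hfg], hs⟩
    · simp only [splitOff, ne_eq, he1, not_false_eq_true, Function.update_of_ne, he2] at he ⊢
      exact hst e he) (le_ncard_cut_splitOff hfg hf hg hcuts hsplit) rfl
  exact exists_family_of_splitOff hf hg hH hHc

end Splitting

section Reduction

variable {ends ends' : E → Sym2 V} {S R : Set V} {v : V} {Q k : ℕ} {P : Fin k → Set E}

lemma IsBalancedSubpartitionAt.of_subset {u u' : V} {P' : Fin k → Set E}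
    (h : IsBalancedSubpartitionAt ends' u' P') (hinc : incEdges ends u = incEdges ends' u')
    (hP : ∀ i, P i ⊆ P' i) : IsBalancedSubpartitionAt ends u P := by
  obtain ⟨⟨h1, h2⟩, P'', ⟨⟨h3, h4⟩, h5, h6⟩, h7⟩ := h
  exact ⟨⟨fun i => (hP i).trans (hinc ▸ h1 i), fun i j hij => (h2 i j hij).mono (hP i) (hP j)⟩,
    P'', ⟨⟨fun i => hinc ▸ h3 i, h4⟩, hinc ▸ h5, h6⟩, fun i => (hP i).trans (h7 i)⟩

/-- A smaller instance of the Extension Theorem has a good packing. -/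
lemma MinExtCex.exists_packing [Finite V] [Finite E] (h : MinExtCex Q k ends S R v P)
    {S' R' : Set V} {v' : V} {P' : Fin k → Set E}
    (hlt : {e | ¬ (ends' e).IsDiag} ⊂ {e | ¬ (ends e).IsDiag})
    (hSR : Disjoint S' R') (hS : 2 ≤ S'.ncard)
    (hconn : EdgeConnectedIn ends' Set.univ S' (Q * k))
    (hR : ∀ r ∈ R', incEdges ends' r = incEdges ends r) (hRR : R' ⊆ R)
    (hv : v' ∈ S') (hloop : ∀ e, v' ∈ ends' e → ¬ (ends' e).IsDiag)
    (hdeg : deg ends' v' = Q * k) (hP : IsBalancedSubpartitionAt ends' v' P')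
    (hP2 : ∀ i, 2 ≤ (P' i).ncard) :
    ∃ H : Fin k → Set E, PairwiseEdgeDisjoint H ∧ (∀ i, ConnectsSet ends' (H i) S') ∧
      BalanceSet ends' H (S' ∪ R') ∧ Extend ends' v' P' H := by
  by_contra hno
  obtain ⟨⟨hQ, hk, -, -, -, hRdeg, -⟩, hmin⟩ := h
  have := hmin V E inferInstance inferInstance ends' S' R' v' P' ⟨hQ, hk, hSR, hS, hconn,
    fun r hr => by
      have := hRdeg r (hRR hr)
      rwa [deg, hR r hr], hv, hloop, hdeg, hP, hP2, hno⟩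
  have h1 := Set.ncard_lt_ncard hlt
  simp only [extMeasure] at this
  omega

open Classical in
/-- If an edge between two vertices outside of `S ∪ R` is deleted in a minimal counterexample,
then `S` is no longer `Qk`-edge-connected. Deletion is modelled by turning the edge into a loop. -/
lemma MinExtCex.not_edgeConnectedIn_update [Finite V] [Finite E] (h : MinExtCex Q k ends S R v P)
    {e : E} {x y : V} (he : ends e = s(x, y)) (hxy : x ≠ y) (hx : x ∉ S ∪ R) (hy : y ∉ S ∪ R) :
    ¬ EdgeConnectedIn (Function.update ends e s(x, x)) Set.univ S (Q * k) := by
  intro hconn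
  set ends' := Function.update ends e s(x, x) with hends'
  have he' : ends' e = s(x, x) := by simp [hends']
  have hne : ∀ f, f ≠ e → ends' f = ends f := fun f hf => by simp [hends', hf]
  have hinc : ∀ u ∈ S ∪ R, incEdges ends' u = incEdges ends u := by
    intro u hu
    ext f
    simp only [incEdges, Set.mem_ofPred_eq]
    by_cases hf : f = e
    · have h1 : u ≠ x := by rintro rfl; exact hx hu
      have h2 : u ≠ y := by rintro rfl; exact hy hu
      simp [hf, he, he', h1, h2]
    · rw [hne f hf]
  obtain ⟨⟨hQ, hk, hSR, hS, -, hRdeg, hv, hloop, hdeg, hP, hP2, hno⟩, -⟩ := id h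
  have hincv : ∀ f, v ∈ ends' f ↔ v ∈ ends f := fun f => by
    have := hinc v (.inl hv)
    exact Set.ext_iff.1 this f
  have hev : v ∉ ends e := by
    rw [← hincv, he']
    have : v ≠ x := by rintro rfl; exact hx (.inl hv)
    simpa using this
  obtain ⟨H, hH, hHc, hHb, hHe⟩ := h.exists_packing (ends' := ends') (S' := S) (R' := R) (v' := v)
    (P' := P) (by
      refine ⟨fun f hf => ?_, fun hsub => ?_⟩
      · by_cases hfe : f = e
        · simp [hfe, he'] at hf
        · simpa [hne f hfe] using hf
      · have := hsub (show e ∈ {e | ¬ (ends e).IsDiag} by simpa [he] using hxy)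
        simp [he'] at this) hSR hS hconn (fun r hr => hinc r (.inr hr)) subset_rfl hv
    (fun f hf => by
      rw [hincv] at hf
      rw [hne f (by rintro rfl; exact hev hf)]
      exact hloop f hf)
    (by rw [deg, hinc v (.inl hv)]; exact hdeg)
    (hP.of_subset (hinc v (.inl hv)) fun _ => subset_rfl) hP2
  have hlift : ∀ (K : Set E) a b, Reaches ends' K a b → Reaches ends (K \ {e}) a b := by
    intro K a b hab
    refine hab.lift id fun f hf a b hab => ?_
    by_cases hfe : f = e
    · rw [hfe, he', Sym2.eq_iff] at hab
      obtain ⟨rfl, rfl⟩ | ⟨rfl, rfl⟩ := hab <;> exact .refl _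
    · exact .of_edge ⟨hf, hfe⟩ (hne f hfe ▸ hab)
  refine hno ⟨fun i => H i \ {e}, fun i j hij => (hH i j hij).mono Set.sdiff_subset
    Set.sdiff_subset, fun i a ha b hb => hlift _ _ _ (hHc i a ha b hb), fun u hu =>
    (hHb u hu).of_subset (hinc u hu).symm fun i f hf => ⟨(hinc u hu).symm ▸ hf.1, hf.2.1⟩,
    fun i => ⟨fun f hf => ⟨(hHe i).1 hf, ?_⟩, ?_⟩⟩
  · rintro rfl
    exact hev (hP.1.1 i hf)
  · rintro ⟨a, b, ha, hb, hab, hnab⟩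
    refine (hHe i).2 ⟨a, b, ha, hb, hab.lift id fun f hf a b hfab =>
      .of_edge hf.1 ((hne f hf.2).trans hfab), fun h1 => hnab ((hlift _ _ _ h1).mono ?_)⟩
    rintro f ⟨⟨h1, h2⟩, h3⟩
    exact ⟨⟨h1, h3⟩, fun h4 => h2 ((hincv f).2 h4)⟩

open Classical in
/-- The contraction of `B` to its vertex `b`; the edges inside `B` become loops at `y`. -/
noncomputable def contract (ends : E → Sym2 V) (B : Set V) (b y : V) (e : E) : Sym2 V :=
  if ∀ z ∈ ends e, z ∈ B then s(y, y) else (ends e).map fun z => if z ∈ B then b else z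

section Contract

variable {B : Set V} {b y : V}

lemma contract_of_inside {e : E} (he : ∀ z ∈ ends e, z ∈ B) : contract ends B b y e = s(y, y) :=
  if_pos he

open Classical in
lemma contract_of_not_inside {e : E} {p q : V} (h : ends e = s(p, q)) (he : ¬ (p ∈ B ∧ q ∈ B)) :
    contract ends B b y e = s(if p ∈ B then b else p, if q ∈ B then b else q) := by
  rw [contract, if_neg (by simpa [h] using he), h, Sym2.map_mk]

lemma contract_of_outside {e : E} (he : ∀ z ∈ ends e, z ∉ B) :
    contract ends B b y e = ends e := by
  classical
  obtain ⟨p, q, h⟩ := exists_ends ends e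
  have hp : p ∉ B := he p (by simp [h])
  have hq : q ∉ B := he q (by simp [h])
  rw [contract_of_not_inside h (by tauto), h, if_neg hp, if_neg hq]

lemma incEdges_contract (hb : b ∈ B) (hy : y ∈ B) {u : V} (hu : u ∉ B) :
    incEdges (contract ends B b y) u = incEdges ends u := by
  classical
  ext e
  obtain ⟨p, q, h⟩ := exists_ends ends e
  have hub : u ≠ b := by rintro rfl; exact hu hb
  have huy : u ≠ y := by rintro rfl; exact hu hy
  simp only [incEdges, Set.mem_ofPred_eq]
  by_cases hpq : p ∈ B ∧ q ∈ B
  · have hup : u ≠ p := by rintro rfl; exact hu hpq.1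
    have huq : u ≠ q := by rintro rfl; exact hu hpq.2
    rw [contract_of_inside (by simpa [h] using hpq), h]
    simp [huy, hup, huq]
  · rw [contract_of_not_inside h hpq, h]
    simp only [Sym2.mem_iff]
    split_ifs with h1 h2 h2
    · exact absurd ⟨h1, h2⟩ hpq
    · have hup : u ≠ p := by rintro rfl; exact hu h1
      simp [hub, hup]
    · have huq : u ≠ q := by rintro rfl; exact hu h2
      simp [hub, huq]
    · rfl

lemma incEdges_contract_self (hb : b ∈ B) (hy : y ≠ b) :
    incEdges (contract ends B b y) b = cut ends B := by
  classical
  ext e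
  obtain ⟨p, q, h⟩ := exists_ends ends e
  rw [mem_cut_iff h]
  simp only [incEdges, Set.mem_ofPred_eq]
  by_cases hpq : p ∈ B ∧ q ∈ B
  · rw [contract_of_inside (by simpa [h] using hpq)]
    simp [hy.symm, hpq]
  · rw [contract_of_not_inside h hpq]
    simp only [Sym2.mem_iff]
    have hp : p ∉ B → b ≠ p := by rintro h rfl; exact h hb
    have hq : q ∉ B → b ≠ q := by rintro h rfl; exact h hb
    split_ifs with h1 h2 h2
    · exact absurd ⟨h1, h2⟩ hpq
    · simp [h1, h2]
    · simp [h1, h2]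
    · simp [h1, h2, hp h1, hq h2]

lemma not_isDiag_contract_of_mem_cut (hb : b ∈ B) {e : E} (he : e ∈ cut ends B) :
    ¬ (contract ends B b y e).IsDiag := by
  classical
  obtain ⟨p, q, h⟩ := exists_ends ends e
  rw [mem_cut_iff h] at he
  rw [contract_of_not_inside h (by tauto), Sym2.mk_isDiag_iff]
  have hp : p ∉ B → b ≠ p := by rintro h rfl; exact h hb
  have hq : q ∉ B → b ≠ q := by rintro h rfl; exact h hb
  split_ifs with h1 h2 h2
  · tauto
  · exact hq h2
  · exact (hp h1).symm
  · tauto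

lemma not_isDiag_of_contract {e : E} (he : ¬ (contract ends B b y e).IsDiag) :
    ¬ (ends e).IsDiag := by
  classical
  obtain ⟨p, q, h⟩ := exists_ends ends e
  rw [h, Sym2.mk_isDiag_iff]
  rintro rfl
  by_cases hp : p ∈ B
  · rw [contract_of_inside (by simpa [h] using hp)] at he
    simp at he
  · rw [contract_of_not_inside h (by tauto)] at he
    simp at he

open Classical in
lemma Reaches.contract {F : Set E} {p q : V} (h : Reaches ends F p q) :
    Reaches (contract ends B b y) F (if p ∈ B then b else p) (if q ∈ B then b else q) := by
  refine h.lift (fun z => if z ∈ B then b else z) fun e he p q hpq => ?_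
  by_cases hB : p ∈ B ∧ q ∈ B
  · simp only [hB, if_true]
    exact .refl _
  · exact .of_edge he (contract_of_not_inside hpq hB)

lemma EdgeConnectedIn.contract [Finite E] {n : ℕ} (h : EdgeConnectedIn ends Set.univ S n)
    (hbS : b ∈ S) (hb : b ∈ B) :
    EdgeConnectedIn (contract ends B b y) Set.univ (insert b (S \ B)) n := by
  classical
  have hfix : ∀ p ∈ insert b (S \ B), p ∈ S ∧ (if p ∈ B then b else p) = p := by
    rintro p (rfl | ⟨h1, h2⟩)
    · exact ⟨hbS, by simp⟩
    · exact ⟨h1, by simp [h2]⟩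
  intro p hp q hq hpq
  obtain ⟨hp1, hp2⟩ := hfix p hp
  obtain ⟨hq1, hq2⟩ := hfix q hq
  obtain ⟨D, hD, hDF, hDr⟩ := edgeDisjointPathsIn_iff.1 (h p hp1 q hq1 hpq)
  refine edgeDisjointPathsIn_iff.2 ⟨D, hD, hDF, fun j => ?_⟩
  have := (hDr j).contract (B := B) (b := b) (y := y)
  rwa [hp2, hq2] at this

end Contract

/-- Both sides of a minimum cut contain an edge if the cut has an edge that leaves `S`. -/
lemma EdgeConnectedIn.exists_edge_outside [Finite E] {n : ℕ} {A : Set V}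
    (h : EdgeConnectedIn ends Set.univ S n) (hA : (cut ends A).ncard ≤ n)
    {e : E} {x y : V} (he : ends e = s(x, y)) (hx : x ∈ A) (hy : y ∉ A) (hyS : y ∉ S)
    (h1 : (A ∩ S).Nonempty) (h2 : (S \ A).Nonempty) :
    ∃ f, ¬ (ends f).IsDiag ∧ ∀ z ∈ ends f, z ∉ A := by
  by_contra! hno
  have h3 := h.le_ncard_cut (X := insert y A) (h1.mono fun z hz => ⟨.inr hz.1, hz.2⟩)
    (by
      obtain ⟨z, hz, hzA⟩ := h2
      exact ⟨z, hz, by rintro (rfl | h); exacts [hyS hz, hzA h]⟩)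
  have hecut : e ∈ cut ends A := by
    rw [mem_cut_iff he]
    tauto
  have h4 : cut ends (insert y A) ∩ Set.univ ⊆ cut ends A \ {e} := by
    rintro f ⟨hf, -⟩
    refine ⟨?_, ?_⟩
    · obtain ⟨p, q, hpq⟩ := exists_ends ends f
      have hf' := hf
      rw [mem_cut_iff hpq] at hf' ⊢
      intro hiff
      have hpA : p ∉ A := fun hp => hf' ⟨fun _ => .inr (hiff.1 hp), fun _ => .inr hp⟩
      obtain ⟨z, hz, hzA⟩ := hno f (by
        rw [hpq, Sym2.mk_isDiag_iff]
        rintro rfl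
        exact hf' Iff.rfl)
      rw [hpq, Sym2.mem_iff] at hz
      obtain rfl | rfl := hz <;> tauto
    · rintro rfl
      rw [mem_cut_iff he] at hf
      exact hf ⟨fun _ => .inl rfl, fun _ => .inr hx⟩
  have h5 := Set.ncard_le_ncard h4
  have h6 := Set.ncard_sdiff_singleton_lt_of_mem hecut
  omega

end Reduction

section Gluing

variable {ends : E → Sym2 V} {S R : Set V} {v : V} {Q k : ℕ} {P : Fin k → Set E}

/-- Gluing, along the cut of `A`, of a connected subgraph `F₁` of the graph in which `Aᶜ` is
contracted and a connected subgraph `F₂` of the graph in which `A` is contracted. -/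
def glue (ends : E → Sym2 V) (A : Set V) (F₁ F₂ : Set E) : Set E :=
  {e | (e ∈ F₁ ∧ ∃ z ∈ ends e, z ∈ A) ∨ (e ∈ F₂ ∧ ∀ z ∈ ends e, z ∉ A)}

lemma glue_properties {A : Set V} {b x y : V} {F₁ F₂ : Set E} (hvS : v ∈ S) (hv : v ∈ A)
    (hb : b ∉ A) (hxv : x ≠ v) (hy : y ∉ A) (hyb : y ≠ b)
    (h₁ : ConnectsSet (contract ends Aᶜ b y) F₁ (insert b (S \ Aᶜ)))
    (h₂ : ConnectsSet (contract ends A v x) F₂ (insert v (S \ A)))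
    (hcross : F₁ ∩ cut ends A ⊆ F₂)
    (hv₁ : ¬ IsCutVertexOf (contract ends Aᶜ b y) F₁ v)
    (hv₂ : ¬ IsCutVertexOf (contract ends A v x) F₂ v) :
    ConnectsSet ends (glue ends A F₁ F₂) S ∧ ¬ IsCutVertexOf ends (glue ends A F₁ F₂) v := by
  classical
  set I : Set E := {e ∈ F₂ | ∀ z ∈ ends e, z ∉ A} with hI
  have hglue : ∀ {p q : V}, p ≠ v → q ≠ v → p ∉ A → q ∉ A →
      Reaches (contract ends A v x) F₂ p q → Reaches ends I p q := by
    intro p q hpv hqv hp hq hpq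
    simp only [IsCutVertexOf, not_exists, not_and, not_not] at hv₂
    refine (hv₂ p q hpv hqv hpq).lift id fun e he p q hpq => ?_
    obtain ⟨heF, hev⟩ := he
    have hev : e ∉ incEdges (contract ends A v x) v := hev
    rw [incEdges_contract_self hv hxv] at hev
    obtain ⟨c, d, hcd⟩ := exists_ends ends e
    rw [mem_cut_iff hcd] at hev
    by_cases hc : c ∈ A
    · have hin : ∀ z ∈ ends e, z ∈ A := by
        intro z hz
        rw [hcd, Sym2.mem_iff] at hz
        obtain rfl | rfl := hz <;> tauto
      rw [contract_of_inside hin, Sym2.eq_iff] at hpq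
      obtain ⟨rfl, rfl⟩ | ⟨rfl, rfl⟩ := hpq <;> exact .refl _
    · have hout : ∀ z ∈ ends e, z ∉ A := by
        intro z hz
        rw [hcd, Sym2.mem_iff] at hz
        obtain rfl | rfl := hz <;> tauto
      rw [contract_of_outside hout] at hpq
      exact .of_edge ⟨heF, hout⟩ hpq
  have hbv : b ≠ v := by rintro rfl; exact hb hv
  have hend : ∀ {e p q}, e ∈ F₁ → ends e = s(p, q) → p ∈ A → q ∉ A →
      Reaches (contract ends A v x) F₂ v q := by
    intro e p q he hpq hp hq
    refine .of_edge (hcross ⟨he, (mem_cut_iff hpq).2 (by tauto)⟩) ?_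
    rw [contract_of_not_inside hpq (by tauto), if_pos hp, if_neg hq]
  have hne : ∀ {q}, q ∉ A → q ≠ v := by rintro q hq rfl; exact hq hv
  obtain ⟨p₁, hp₁, hvp₁⟩ : ∃ p₁ ∉ A, Reaches (contract ends A v x) F₂ v p₁ := by
    obtain ⟨e, he, heb⟩ := (h₁ b (.inl rfl) v (.inr ⟨hvS, by simpa using hv⟩)).exists_incident hbv
    have heb : e ∈ incEdges (contract ends Aᶜ b y) b := heb
    rw [incEdges_contract_self hb hyb] at heb
    obtain ⟨p, q, hpq⟩ := exists_ends ends e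
    rw [mem_cut_iff hpq, Set.mem_compl_iff, Set.mem_compl_iff] at heb
    by_cases hp : p ∈ A
    · have hq : q ∉ A := by tauto
      exact ⟨q, hq, hend he hpq hp hq⟩
    · have hq : q ∈ A := by tauto
      exact ⟨p, hp, hend he (hpq.trans Sym2.eq_swap) hq hp⟩
  have hI₁ : ∀ {e p q}, e ∈ F₁ → ends e = s(p, q) → p ∈ A → q ∉ A → Reaches ends I q p₁ :=
    fun he hpq hp hq => hglue (hne hq) (hne hp₁) hq hp₁ ((hend he hpq hp hq).symm.trans hvp₁)
  have hIg : I ⊆ glue ends A F₁ F₂ := fun e he => .inr he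
  set ℓ : V → V := fun z => if z ∈ A then z else p₁ with hℓ
  set φ : V → V := fun z => if z ∈ Aᶜ then b else z with hφ
  have hℓA : ∀ {z}, z ∈ A → ℓ z = z := fun hz => if_pos hz
  have hℓφ : ∀ z, ℓ (φ z) = ℓ z := by
    intro z
    by_cases hz : z ∈ A <;> simp [hℓ, hφ, hz, hb]
  have hφc : ∀ {e c d}, ends e = s(c, d) → ¬ (c ∈ Aᶜ ∧ d ∈ Aᶜ) →
      contract ends Aᶜ b y e = s(φ c, φ d) := by
    intro e c d hcd hin
    rw [contract_of_not_inside hcd hin]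
    by_cases hc : c ∈ A <;> by_cases hd : d ∈ A <;> simp [hφ, hc, hd]
  have hlift : ∀ (K₁ K : Set E), K₁ ⊆ F₁ → I ⊆ K →
      (∀ e ∈ K₁, (∃ z ∈ ends e, z ∈ A) → e ∈ K) → ∀ {p q},
      Reaches (contract ends Aᶜ b y) K₁ p q → Reaches ends K (ℓ p) (ℓ q) := by
    intro K₁ K hK₁ hIK hK p q hpq
    refine hpq.lift ℓ fun e he p q hpq => ?_
    obtain ⟨c, d, hcd⟩ := exists_ends ends e
    by_cases hin : c ∈ Aᶜ ∧ d ∈ Aᶜ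
    · rw [contract_of_inside (by simpa [hcd] using hin), Sym2.eq_iff] at hpq
      obtain ⟨rfl, rfl⟩ | ⟨rfl, rfl⟩ := hpq <;> exact .refl _
    · have h3 : contract ends Aᶜ b y e = s(φ c, φ d) := hφc hcd hin
      have heK : e ∈ K := hK e he (by
        by_cases hc : c ∈ A
        · exact ⟨c, by simp [hcd], hc⟩
        · exact ⟨d, by simp [hcd], by simp only [Set.mem_compl_iff] at hin; tauto⟩)
      have h4 : Reaches ends K (ℓ c) (ℓ d) := by
        by_cases hc : c ∈ A <;> by_cases hd : d ∈ A
        · rw [hℓA hc, hℓA hd]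
          exact .of_edge heK hcd
        · rw [hℓA hc, show ℓ d = p₁ from if_neg hd]
          exact (Reaches.of_edge heK hcd).trans ((hI₁ (hK₁ he) hcd hc hd).mono hIK)
        · rw [hℓA hd, show ℓ c = p₁ from if_neg hc]
          exact Reaches.symm ((Reaches.of_edge heK (hcd.trans Sym2.eq_swap)).trans
            ((hI₁ (hK₁ he) (hcd.trans Sym2.eq_swap) hd hc).mono hIK))
        · exact absurd ⟨hc, hd⟩ hin
      rw [h3, Sym2.eq_iff] at hpq
      obtain ⟨rfl, rfl⟩ | ⟨rfl, rfl⟩ := hpq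
      · rw [hℓφ, hℓφ]
        exact h4
      · rw [hℓφ, hℓφ]
        exact h4.symm
  refine ⟨?_, ?_⟩
  · have hself : ∀ p ∈ S, Reaches ends (glue ends A F₁ F₂) p (ℓ p) := by
      intro p hp
      by_cases hpA : p ∈ A
      · rw [hℓA hpA]
        exact .refl _
      · rw [show ℓ p = p₁ from if_neg hpA]
        exact (hglue (hne hpA) (hne hp₁) hpA hp₁
          ((h₂ p (.inr ⟨hp, hpA⟩) v (.inl rfl)).trans hvp₁)).mono hIg
    have hφS : ∀ p ∈ S, φ p ∈ insert b (S \ Aᶜ) := by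
      intro p hp
      by_cases hpA : p ∈ A
      · exact .inr ⟨by simpa [hφ, hpA] using hp, by simp [hφ, hpA]⟩
      · exact .inl (by simp [hφ, hpA])
    intro p hp q hq
    have h3 := hlift F₁ (glue ends A F₁ F₂) subset_rfl hIg (fun e he hz => .inl ⟨he, hz⟩)
      (h₁ _ (hφS p hp) _ (hφS q hq))
    rw [hℓφ, hℓφ] at h3
    exact (hself p hp).trans (h3.trans (hself q hq).symm)
  · rintro ⟨p, q, hp, hq, hpq, hnpq⟩
    set K : Set E := {e ∈ glue ends A F₁ F₂ | v ∉ ends e} with hKdef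
    have hIK : I ⊆ K := fun e he => ⟨hIg he, fun hve => he.2 v hve hv⟩
    have hisol : ∀ {p q}, p ∉ A → ¬ Reaches ends I p p₁ →
        Reaches ends (glue ends A F₁ F₂) p q → Reaches ends I p q := by
      intro p q hp hpp hpq
      suffices h : q ∉ A ∧ Reaches ends I p q from h.2
      induction hpq with
      | refl => exact ⟨hp, .refl _⟩
      | @tail u w _ hs ih =>
        obtain ⟨e, he, huw⟩ := hs
        obtain ⟨hu, hpu⟩ := ih
        by_cases hw : w ∈ A
        · obtain ⟨he, -⟩ | ⟨-, he⟩ := he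
          · exact absurd (hpu.trans (hI₁ he (huw.trans Sym2.eq_swap) hw hu)) hpp
          · exact absurd hw (he w (by simp [huw]))
        · refine ⟨hw, hpu.trans (.of_edge (e := e) ⟨?_, ?_⟩ huw)⟩
          · obtain ⟨-, z, hz, hzA⟩ | ⟨he, -⟩ := he
            · rw [huw, Sym2.mem_iff] at hz
              obtain rfl | rfl := hz
              · exact absurd hzA hu
              · exact absurd hzA hw
            · exact he
          · intro z hz
            rw [huw, Sym2.mem_iff] at hz
            obtain rfl | rfl := hz <;> assumption
    have hself : ∀ p, p ∉ A → Reaches ends I p p₁ → Reaches ends K p (ℓ p) := by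
      intro p hpA h
      rw [show ℓ p = p₁ from if_neg hpA]
      exact h.mono hIK
    have hself' : ∀ {p}, ¬ (p ∉ A ∧ ¬ Reaches ends I p p₁) → Reaches ends K p (ℓ p) := by
      intro p hp
      by_cases hpA : p ∈ A
      · rw [hℓA hpA]
        exact .refl _
      · exact hself p hpA (by tauto)
    by_cases hp' : p ∉ A ∧ ¬ Reaches ends I p p₁
    · exact hnpq ((hisol hp'.1 hp'.2 hpq).mono hIK)
    by_cases hq' : q ∉ A ∧ ¬ Reaches ends I q p₁
    · exact hnpq ((hisol hq'.1 hq'.2 hpq.symm).mono hIK).symm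
    have hφv : ∀ {p}, p ≠ v → φ p ≠ v := by
      intro p hp
      by_cases hpA : p ∈ A
      · simpa [hφ, hpA] using hp
      · simpa [hφ, hpA] using hbv
    have h3 : Reaches (contract ends Aᶜ b y) F₁ (φ p) (φ q) := by
      refine hpq.lift φ fun e he c d hcd => ?_
      by_cases hin : c ∈ Aᶜ ∧ d ∈ Aᶜ
      · simp only [hφ, hin, if_true]
        exact .refl _
      · refine .of_edge (e := e) ?_ (hφc hcd hin)
        obtain ⟨he, -⟩ | ⟨-, he⟩ := he
        · exact he
        · exact absurd ⟨he c (by simp [hcd]), he d (by simp [hcd])⟩ hin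
    simp only [IsCutVertexOf, not_exists, not_and, not_not] at hv₁
    have h4 := hlift {e ∈ F₁ | v ∉ contract ends Aᶜ b y e} K (fun e he => he.1) hIK
      (fun e he hz => ⟨.inl ⟨he.1, hz⟩, fun hve => he.2 (by
        have : e ∈ incEdges ends v := hve
        rwa [← incEdges_contract (B := Aᶜ) (b := b) (y := y) hb hy (by simpa using hv)] at this)⟩)
      (hv₁ _ _ (hφv hp) (hφv hq) h3)
    rw [hℓφ, hℓφ] at h4
    exact hnpq ((hself' hp').trans (h4.trans (hself' hq').symm))

/-- In a minimal counterexample, no edge between two vertices outside of `S ∪ R` lies in a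
minimum cut separating `S`. -/
lemma MinExtCex.false_of_tight_cut [Finite V] [Finite E] (h : MinExtCex Q k ends S R v P)
    {A : Set V} {b x y : V} {e : E} (hv : v ∈ A) (hbS : b ∈ S) (hb : b ∉ A)
    (hA : (cut ends A).ncard = Q * k) (he : ends e = s(x, y)) (hx : x ∈ A) (hy : y ∉ A)
    (hxU : x ∉ S ∪ R) (hyU : y ∉ S ∪ R) : False := by
  obtain ⟨⟨hQ, hk, hSR, hS, hconn, hRdeg, hvS, hloop, hdeg, hP, hP2, hno⟩, -⟩ := id h
  have hbv : b ≠ v := by rintro rfl; exact hb hv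
  have hxv : x ≠ v := by rintro rfl; exact hxU (.inl hvS)
  have hyb : y ≠ b := by rintro rfl; exact hyU (.inl hbS)
  have hbA : b ∈ Aᶜ := hb
  have hyA : y ∈ Aᶜ := hy
  have hvA : v ∉ Aᶜ := by simpa using hv
  have hR : ∀ B : Set V, Disjoint (R \ B) (S \ B) := fun B =>
    (hSR.mono Set.sdiff_subset Set.sdiff_subset).symm
  have hinc₁ : ∀ {u}, u ∈ A → incEdges (contract ends Aᶜ b y) u = incEdges ends u := fun hu =>
    incEdges_contract hbA hyA (by simpa using hu)
  have hinc₂ : ∀ {u}, u ∉ A → incEdges (contract ends A v x) u = incEdges ends u := fun hu =>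
    incEdges_contract hv hx hu
  have hincv : incEdges (contract ends A v x) v = cut ends A := incEdges_contract_self hv hxv
  have hincb : incEdges (contract ends Aᶜ b y) b = cut ends A :=
    (incEdges_contract_self hbA hyb).trans (cut_compl A)
  have hsub : ∀ (B : Set V) (c z : V), (∃ f, ¬ (ends f).IsDiag ∧ ∀ z ∈ ends f, z ∈ B) →
      {e | ¬ (contract ends B c z e).IsDiag} ⊂ {e | ¬ (ends e).IsDiag} := by
    rintro B c z ⟨f, hf, hfB⟩
    refine ⟨fun e he => not_isDiag_of_contract he, fun hsub => ?_⟩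
    have := hsub (show f ∈ {e | ¬ (ends e).IsDiag} from hf)
    simp [contract_of_inside hfB] at this
  have htwo : ∀ {c : V} {B : Set V} {d : V}, d ∈ S → d ∉ B → c ≠ d →
      2 ≤ (insert c (S \ B)).ncard := by
    intro c B d hd hdB hcd
    rw [← Set.ncard_pair hcd]
    refine Set.ncard_le_ncard ?_
    rintro z (rfl | rfl)
    · exact .inl rfl
    · exact .inr ⟨hd, hdB⟩
  obtain ⟨H₁, hH₁, hc₁, hb₁, he₁⟩ := h.exists_packing (ends' := contract ends Aᶜ b y)
    (S' := insert b (S \ Aᶜ)) (R' := R \ Aᶜ) (v' := v) (P' := P)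
    (hsub _ _ _ (hconn.exists_edge_outside hA.le he hx hy (fun h => hyU (.inl h)) ⟨v, hv, hvS⟩
      ⟨b, hbS, hb⟩))
    (Set.disjoint_insert_left.2 ⟨fun h => h.2 hbA, (hR _).symm⟩) (htwo hvS hvA hbv)
    (hconn.contract hbS hbA) (fun r hr => hinc₁ (by simpa using hr.2)) Set.sdiff_subset
    (.inr ⟨hvS, hvA⟩) (fun f hf => by
      have hf' : f ∈ incEdges (contract ends Aᶜ b y) v := hf
      rw [hinc₁ hv] at hf'
      by_cases hfA : f ∈ cut ends A
      · exact not_isDiag_contract_of_mem_cut hbA (by rwa [cut_compl])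
      obtain ⟨p, q, hpq⟩ := exists_ends ends f
      rw [contract_of_outside]
      · exact hloop f hf'
      · have hvf : v ∈ ends f := hf'
        rw [mem_cut_iff hpq] at hfA
        rw [hpq, Sym2.mem_iff] at hvf
        intro z hz
        rw [hpq, Sym2.mem_iff] at hz
        simp only [Set.mem_compl_iff, not_not]
        obtain rfl | rfl := hvf <;> obtain rfl | rfl := hz <;> tauto)
    (by rw [deg, hinc₁ hv]; exact hdeg) (hP.of_subset (hinc₁ hv) fun _ => subset_rfl) hP2
  obtain ⟨-, P₂, ⟨hP₂, hP₂cov, hP₂two⟩, hP₂sub⟩ := hb₁ b (.inl (.inl rfl))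
  have hP₂' : IsBalancedSubpartitionAt (contract ends A v x) v P₂ :=
    IsBalancedSubpartitionAt.of_subset ⟨hP₂, P₂, ⟨hP₂, hP₂cov, hP₂two⟩, fun _ => subset_rfl⟩
      (hincv.trans hincb.symm) fun _ => subset_rfl
  obtain ⟨H₂, hH₂, hc₂, hb₂, he₂⟩ := h.exists_packing (ends' := contract ends A v x)
    (S' := insert v (S \ A)) (R' := R \ A) (v' := v) (P' := P₂)
    (hsub _ _ _ (by
      obtain ⟨f, hf, hfA⟩ := hconn.exists_edge_outside (A := Aᶜ) (by rw [cut_compl, hA])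
        (he.trans Sym2.eq_swap) hyA (by simpa using hx) (fun h => hxU (.inl h)) ⟨b, hb, hbS⟩
        ⟨v, hvS, hvA⟩
      exact ⟨f, hf, fun z hz => by simpa using hfA z hz⟩))
    (Set.disjoint_insert_left.2 ⟨fun h => h.2 hv, (hR _).symm⟩) (htwo hbS hb hbv.symm)
    (hconn.contract hvS hv) (fun r hr => hinc₂ hr.2) Set.sdiff_subset (.inl rfl)
    (fun f hf => not_isDiag_contract_of_mem_cut hv (by
      rw [← hincv]
      exact hf))
    (by rw [deg, hincv, hA]) hP₂' hP₂two
  have hcross : ∀ i, H₁ i ∩ cut ends A ⊆ H₂ i := fun i f hf =>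
    (he₂ i).1 (hP₂sub i ⟨hincb ▸ hf.2, hf.1⟩)
  have hglue := fun i => glue_properties (ends := ends) hvS hv hb hxv hy hyb (hc₁ i)
    (hc₂ i) (hcross i) (he₁ i).2 (he₂ i).2
  refine hno ⟨fun i => glue ends A (H₁ i) (H₂ i), fun i j hij => ?_, fun i => (hglue i).1,
    fun u hu => ?_, fun i => ⟨fun f hf => ?_, (hglue i).2⟩⟩
  · rw [Set.disjoint_left]
    rintro f (⟨h1, z, hz, hzA⟩ | ⟨h1, h2⟩) (⟨h3, z', hz', hzA'⟩ | ⟨h3, h4⟩)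
    · exact Set.disjoint_left.1 (hH₁ i j hij) h1 h3
    · exact h4 z hz hzA
    · exact h2 z' hz' hzA'
    · exact Set.disjoint_left.1 (hH₂ i j hij) h1 h3
  · by_cases huA : u ∈ A
    · have huSR : u ∈ insert b (S \ Aᶜ) ∪ R \ Aᶜ := by
        have huA' : u ∉ Aᶜ := by simpa using huA
        exact hu.imp (fun h => .inr ⟨h, huA'⟩) (fun h => ⟨h, huA'⟩)
      refine (hb₁ u huSR).of_subset (hinc₁ huA).symm fun i f hf => ⟨(hinc₁ huA).symm ▸ hf.1, ?_⟩
      obtain ⟨h1, -⟩ | ⟨-, h1⟩ := hf.2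
      · exact h1
      · exact absurd huA (h1 u hf.1)
    · have huSR : u ∈ insert v (S \ A) ∪ R \ A :=
        hu.imp (fun h => .inr ⟨h, huA⟩) (fun h => ⟨h, huA⟩)
      refine (hb₂ u huSR).of_subset (hinc₂ huA).symm fun i f hf => ⟨(hinc₂ huA).symm ▸ hf.1, ?_⟩
      obtain ⟨h1, hz⟩ | ⟨h1, -⟩ := hf.2
      · exact hcross i ⟨h1, hz, u, hf.1, huA⟩
      · exact h1
  · exact .inl ⟨(he₁ i).1 hf, v, hP.1.1 i hf, hv⟩

/-- In a minimal counterexample, the vertices outside of `S ∪ R` are pairwise non-adjacent. -/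
theorem MinExtCex.exists_mem_of_not_isDiag [Finite V] [Finite E] (h : MinExtCex Q k ends S R v P)
    {e : E} (he : ¬ (ends e).IsDiag) : ∃ z ∈ ends e, z ∈ S ∪ R := by
  classical
  by_contra! hU
  obtain ⟨x, y, hxy⟩ := exists_ends ends e
  have hx := hU x (by simp [hxy])
  have hy := hU y (by simp [hxy])
  have hne : x ≠ y := by simpa [hxy] using he
  have hno := h.not_edgeConnectedIn_update hxy hne hx hy
  have hconn := h.1.2.2.2.2.1
  have hvS := h.1.2.2.2.2.2.2.1
  simp only [EdgeConnectedIn, not_forall] at hno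
  obtain ⟨a, ha, b, hb, -, hno⟩ := hno
  obtain ⟨X, haX, hbX, hX⟩ : ∃ X : Set V, a ∈ X ∧ b ∉ X ∧
      (cut (Function.update ends e s(x, x)) X).ncard < Q * k := by
    by_contra! hcut
    exact hno (edgeDisjointPathsIn_of_le_ncard_cut hcut)
  have hge := hconn.le_ncard_cut (X := X) ⟨a, haX, ha⟩ ⟨b, hb, hbX⟩
  rw [Set.inter_univ] at hge
  have hsub : cut ends X ⊆ insert e (cut (Function.update ends e s(x, x)) X) := by
    intro f hf
    by_cases hfe : f = e
    · exact .inl hfe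
    · right
      simpa [cut, hfe] using hf
  have h1 := Set.ncard_le_ncard hsub
  have h2 := Set.ncard_insert_le e (cut (Function.update ends e s(x, x)) X)
  have heX : e ∈ cut ends X := by
    by_contra heX
    have h3 : cut ends X ⊆ cut (Function.update ends e s(x, x)) X := fun f hf =>
      (hsub hf).resolve_left (by rintro rfl; exact heX hf)
    have := Set.ncard_le_ncard h3
    omega
  have hcard : (cut ends X).ncard = Q * k := by omega
  have main : ∀ A : Set V, ∀ b, v ∈ A → b ∈ S → b ∉ A → (cut ends A).ncard = Q * k →
      e ∈ cut ends A → False := by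
    intro A b hv hb hbA hA heA
    rw [mem_cut_iff hxy] at heA
    by_cases hxA : x ∈ A
    · exact h.false_of_tight_cut hv hb hbA hA hxy hxA (by tauto) hx hy
    · exact h.false_of_tight_cut hv hb hbA hA (hxy.trans Sym2.eq_swap) (by tauto) hxA hy hx
  by_cases hvX : v ∈ X
  · exact main X b hvX hb hbX hcard heX
  · exact main Xᶜ a hvX ha (by simpa using haX) (by rw [cut_compl, hcard]) (by rwa [cut_compl])

end Gluing

section Packing

variable {ends : E → Sym2 V} {S R : Set V} {v : V} {Q k : ℕ} {P : Fin k → Set E}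

lemma not_isCutVertexOf {H : Set E} {t : V} (htv : t ≠ v)
    (h : ∀ e ∈ H, ∀ z, ends e = s(v, z) → Reaches ends {e ∈ H | v ∉ ends e} z t) :
    ¬ IsCutVertexOf ends H v := by
  classical
  rintro ⟨a, b, ha, hb, hab, hnab⟩
  refine hnab ?_
  set φ : V → V := fun z => if z = v then t else z with hφ
  have key : Reaches ends {e ∈ H | v ∉ ends e} (φ a) (φ b) := by
    refine hab.lift φ fun e he p q hpq => ?_
    by_cases hp : p = v
    · subst hp
      have h1 := (h e he q hpq).symm
      by_cases hq : q = p
      · simp only [hφ, hq]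
        exact .refl _
      · simpa [hφ, hq] using h1
    · by_cases hq : q = v
      · subst hq
        simpa [hφ, hp] using h e he p (hpq.trans Sym2.eq_swap)
      · simp only [hφ, hp, hq, if_false]
        refine .of_edge (e := e) ⟨he, ?_⟩ hpq
        rw [hpq, Sym2.mem_iff]
        rintro (rfl | rfl) <;> contradiction
  simpa [hφ, ha, hb] using key

lemma balanceVertex_of_two_le [Finite E] (hk : 0 < k) {H : Fin k → Set E}
    (hH : PairwiseEdgeDisjoint H) {u : V} (h : ∀ i, 2 ≤ (incEdges ends u ∩ H i).ncard) :
    BalanceVertex ends H u := by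
  classical
  have hdis : ∀ i j, i ≠ j → Disjoint (incEdges ends u ∩ H i) (incEdges ends u ∩ H j) :=
    fun i j hij => (hH i j hij).mono Set.inter_subset_right Set.inter_subset_right
  refine ⟨⟨fun i => Set.inter_subset_left, hdis⟩,
    fun i => incEdges ends u ∩ (H i ∪ {e | i = ⟨0, hk⟩ ∧ ∀ j, e ∉ H j}),
    ⟨⟨fun i => Set.inter_subset_left, fun i j hij => ?_⟩, ?_, fun i => ?_⟩,
    fun i => Set.inter_subset_inter_right _ Set.subset_union_left⟩
  · rw [Set.disjoint_left]
    rintro e ⟨-, h1 | ⟨rfl, h1⟩⟩ ⟨-, h2 | ⟨rfl, h2⟩⟩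
    · exact Set.disjoint_left.1 (hH i j hij) h1 h2
    · exact h2 i h1
    · exact h1 j h2
    · exact hij rfl
  · refine Set.Subset.antisymm (Set.iUnion_subset fun i => Set.inter_subset_left) fun e he => ?_
    by_cases hex : ∃ j, e ∈ H j
    · obtain ⟨j, hj⟩ := hex
      exact Set.mem_iUnion.2 ⟨j, he, .inl hj⟩
    · exact Set.mem_iUnion.2 ⟨⟨0, hk⟩, he, .inr ⟨rfl, by simpa using hex⟩⟩
  · exact (h i).trans (Set.ncard_le_ncard (Set.inter_subset_inter_right _ Set.subset_union_left))

/-- `exists_connecting_family` inside of a subgraph, with the trees grouped in pairs. -/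
lemma EdgeConnectedIn.exists_connecting_pairs [Finite V] [Finite E] {F : Set E} {T : Set V}
    (hc : EdgeConnectedIn ends F T (6 * k))
    (hst : ∀ e ∈ F, ¬ (ends e).IsDiag → ∃ z ∈ ends e, z ∈ T) (x : V) :
    ∃ K : Fin k × Fin 2 → Set E, (∀ i, K i ⊆ F) ∧ (∀ i j, i ≠ j → Disjoint (K i) (K j)) ∧
      ∀ i, ConnectsSet ends (K i) T := by
  classical
  set ends' : E → Sym2 V := fun e => if e ∈ F then ends e else s(x, x) with hends'
  have hcut : ∀ X, cut ends' X = cut ends X ∩ F := by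
    intro X
    ext e
    by_cases he : e ∈ F
    · simp [cut, hends', he]
    · simp [cut, hends', he]
  obtain ⟨H, hH, hHc⟩ := exists_connecting_family (m := k * 2) ends' (T := T)
    (fun e he => by
      by_cases heF : e ∈ F
      · simp only [hends', heF, if_true] at he ⊢
        exact hst e heF he
      · simp [hends', heF] at he)
    (fun X h1 h2 => by
      have := hc.le_ncard_cut h1 h2
      rw [hcut]
      omega)
  refine ⟨fun i => H (finProdFinEquiv i) ∩ F, fun i => Set.inter_subset_right, fun i j hij =>
    (hH _ _ (finProdFinEquiv.injective.ne hij)).mono Set.inter_subset_left Set.inter_subset_left,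
    fun i a ha b hb => ?_⟩
  refine (hHc (finProdFinEquiv i) a ha b hb).lift id fun e he p q hpq => ?_
  by_cases heF : e ∈ F
  · simp only [hends', heF, if_true] at hpq
    exact .of_edge (e := e) ⟨he, heF⟩ hpq
  · simp only [hends', heF, if_false, Sym2.eq_iff] at hpq
    obtain ⟨rfl, rfl⟩ | ⟨rfl, rfl⟩ := hpq <;> exact .refl _

/-- In a minimal counterexample, the edges from `v` to vertices outside of `S ∪ R` can be extended,
injectively, by edges leading back to `(S ∪ R) \ {v}`. -/
lemma MinExtCex.exists_extension [Finite V] [Finite E] (h : MinExtCex Q k ends S R v P) :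
    ∃ f : E → E, Set.InjOn f {e | ∃ w ∉ S ∪ R, ends e = s(v, w)} ∧
      ∀ e, ∀ w ∉ S ∪ R, ends e = s(v, w) → ∃ z ∈ (S ∪ R) \ {v}, ends (f e) = s(w, z) := by
  classical
  obtain ⟨-, hk, -, hS, hconn, -, hvS, hloop, hdeg, -⟩ := id h.1
  set D : V → Set E := fun w => {e | ends e = s(v, w)} with hD
  set C : V → Set E := fun w => {e | ∃ z ∈ (S ∪ R) \ {v}, ends e = s(w, z)} with hC
  have hle : ∀ w ∉ S ∪ R, (D w).ncard ≤ (C w).ncard := by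
    intro w hw
    obtain ⟨s, hs, hsv⟩ := Set.exists_ne_of_one_lt_ncard (show 1 < S.ncard by omega) v
    have hsw : s ≠ w := by
      rintro rfl
      exact hw (.inl hs)
    have h1 := hconn.le_ncard_cut (X := {v, w}) ⟨v, by simp, hvS⟩ ⟨s, hs, by simp [hsv, hsw]⟩
    rw [Set.inter_univ] at h1
    have hsub : cut ends {v, w} ⊆ (incEdges ends v \ D w) ∪ C w := by
      intro e he
      obtain ⟨⟨p, hpe, hp⟩, q, hqe, hq⟩ := id he
      have hpq : p ≠ q := by
        rintro rfl
        exact hq hp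
      have hends : ends e = s(p, q) := (Sym2.mem_and_mem_iff hpq).1 ⟨hpe, hqe⟩
      simp only [Set.mem_insert_iff, Set.mem_singleton_iff, not_or] at hp hq
      obtain rfl | rfl := hp
      · refine .inl ⟨hpe, fun hew => ?_⟩
        have hew : ends e = s(p, w) := hew
        rw [hends, Sym2.congr_right] at hew
        exact hq.2 hew
      · refine .inr ⟨q, ⟨?_, hq.1⟩, hends⟩
        obtain ⟨z, hz, hzU⟩ := h.exists_mem_of_not_isDiag (e := e) (by simpa [hends] using hpq)
        rw [hends, Sym2.mem_iff] at hz
        obtain rfl | rfl := hz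
        · exact absurd hzU hw
        · exact hzU
    have h2 := (Set.ncard_le_ncard hsub).trans (Set.ncard_union_le _ _)
    have hDsub : D w ⊆ incEdges ends v := by
      intro e he
      have he : ends e = s(v, w) := he
      simp [incEdges, he]
    have h3 := Set.ncard_sdiff_add_ncard_of_subset hDsub
    rw [deg] at hdeg
    omega
  have hg : ∀ w, ∃ g : E → E, w ∉ S ∪ R → Set.MapsTo g (D w) (C w) ∧ Set.InjOn g (D w) := by
    intro w
    by_cases hw : w ∉ S ∪ R
    · obtain ⟨g, hg⟩ : ∃ g : D w → C w, Function.Injective g := by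
        have h1 : Nat.card (D w) ≤ Nat.card (C w) := hle w hw
        have := Fintype.ofFinite (D w)
        have := Fintype.ofFinite (C w)
        rw [Nat.card_eq_fintype_card, Nat.card_eq_fintype_card] at h1
        obtain ⟨g⟩ := Function.Embedding.nonempty_of_card_le h1
        exact ⟨g, g.injective⟩
      refine ⟨fun e => if he : e ∈ D w then g ⟨e, he⟩ else e, fun _ => ⟨fun e he => ?_,
        fun e he e' he' hee => ?_⟩⟩
      · simp [he]
      · simp only [he, he', dif_pos] at hee
        exact congrArg Subtype.val (hg (Subtype.ext hee))
    · exact ⟨id, fun h => absurd h hw⟩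
  choose g hg using hg
  have hdef : ∃ f : E → E, ∀ e w, ends e = s(v, w) → f e = g w e := by
    refine ⟨fun e => if he : ∃ w, ends e = s(v, w) then g he.choose e else e, fun e w he => ?_⟩
    have hex : ∃ w, ends e = s(v, w) := ⟨w, he⟩
    have : hex.choose = w := Sym2.congr_right.1 (hex.choose_spec.symm.trans he)
    simp only [hex, dif_pos]
    rw [this]
  obtain ⟨f, hf⟩ := hdef
  have hfC : ∀ e, ∀ w ∉ S ∪ R, ends e = s(v, w) →
      ∃ z ∈ (S ∪ R) \ {v}, ends (f e) = s(w, z) := fun e w hw he => by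
    rw [hf e w he]
    exact (hg w hw).1 he
  refine ⟨f, ?_, hfC⟩
  rintro e ⟨w, hw, he⟩ e' ⟨w', hw', he'⟩ hee
  obtain ⟨z, hz, hfe⟩ := hfC e w hw he
  obtain ⟨z', hz', hfe'⟩ := hfC e' w' hw' he'
  have hww : w = w' := by
    rw [← hee, hfe, Sym2.eq_iff] at hfe'
    obtain ⟨h1, -⟩ | ⟨rfl, -⟩ := hfe'
    · exact h1
    · exact absurd hz'.1 hw
  subst hww
  rw [hf e w he, hf e' w he'] at hee
  exact (hg w hw).2 he he' hee

end Packing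

/-- Let `(G, S, R, v, P, Q, k)` be a minimal counterexample
to the Extension Theorem, `W` the set of neighbors of `v` not in `S ∪ R`, and
`G' = G − v − W`.  Then `(S ∪ R) − {v}` is not `6k`-edge-connected in `G'`. -/
theorem min_cex_Gprime_not_6k {V E : Type} [Fintype V] [Fintype E]
    (Q k : ℕ) (ends : E → Sym2 V) (S R : Set V) (v : V) (P : Fin k → Set E)
    (h : MinExtCex Q k ends S R v P)
    (W : Set V) (hW : W = neighbors ends v \ (S ∪ R))
    (F : Set E) (hF : F = {e : E | ∀ x ∈ ends e, x ≠ v ∧ x ∉ W}) :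
    ¬ EdgeConnectedIn ends F ((S ∪ R) \ {v}) (6 * k) := by
  classical
  intro hc
  obtain ⟨-, hk, -, hS, -, -, hvS, hloop, -, hP, hP2, hno⟩ := id h.1
  have hFv : ∀ {e}, e ∈ F → v ∉ ends e := by
    intro e he hv
    rw [hF] at he
    exact (he v hv).1 rfl
  obtain ⟨K, hKF, hK, hKc⟩ := hc.exists_connecting_pairs (fun e he hd => by
    obtain ⟨z, hz, hzU⟩ := h.exists_mem_of_not_isDiag hd
    exact ⟨z, hz, hzU, fun hzv => hFv he (hzv ▸ hz)⟩) v
  obtain ⟨f, hfinj, hf⟩ := h.exists_extension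
  obtain ⟨t₀, ht₀, ht₀v⟩ := Set.exists_ne_of_one_lt_ncard (show 1 < S.ncard by omega) v
  set T : Set V := (S ∪ R) \ {v} with hT
  have ht₀T : t₀ ∈ T := ⟨.inl ht₀, ht₀v⟩
  set N : Set E := {e | ∃ w ∉ S ∪ R, ends e = s(v, w)} with hN
  have hPv : ∀ {i e}, e ∈ P i → v ∈ ends e := fun {i e} he => hP.1.1 i he
  have hPends : ∀ {i e}, e ∈ P i → ∃ z, z ≠ v ∧ ends e = s(v, z) := by
    intro i e he
    obtain ⟨z, hz⟩ := hPv he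
    refine ⟨z, ?_, hz⟩
    rintro rfl
    exact hloop e (hPv he) (by simp [hz])
  have hfv : ∀ {e}, e ∈ N → v ∉ ends (f e) := by
    rintro e ⟨w, hw, he⟩
    obtain ⟨z, hz, hfe⟩ := hf e w hw he
    rw [hfe, Sym2.mem_iff]
    rintro (rfl | rfl)
    · exact hw (.inl hvS)
    · exact hz.2 rfl
  have hfF : ∀ {e}, e ∈ N → f e ∉ F := by
    rintro e ⟨w, hw, he⟩ hfe
    obtain ⟨z, hz, hfe'⟩ := hf e w hw he
    rw [hF] at hfe
    exact (hfe w (by simp [hfe'])).2 (by rw [hW]; exact ⟨⟨e, he⟩, hw⟩)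
  set H : Fin k → Set E := fun i => K (i, 0) ∪ K (i, 1) ∪ P i ∪ f '' (P i ∩ N) with hH
  have hHK : ∀ i j, K (i, j) ⊆ H i := by
    intro i j e he
    match j with
    | 0 => exact .inl (.inl (.inl he))
    | 1 => exact .inl (.inl (.inr he))
  have hHP : ∀ i, P i ⊆ H i := fun i e he => .inl (.inr he)
  have hHf : ∀ {i e}, e ∈ P i → e ∈ N → f e ∈ H i := fun he he' => .inr ⟨_, ⟨he, he'⟩, rfl⟩
  have hKH : ∀ i, K (i, 0) ∪ K (i, 1) ⊆ F := fun i => Set.union_subset (hKF _) (hKF _)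
  have hHdis : PairwiseEdgeDisjoint H := by
    intro i j hij
    rw [Set.disjoint_left]
    have hPf : ∀ {i j e}, e ∈ P i → e ∈ f '' (P j ∩ N) → False := by
      rintro i j _ he ⟨e, he', rfl⟩
      exact hfv he'.2 (hPv he)
    have hKf : ∀ {i j e}, e ∈ K (i, 0) ∪ K (i, 1) → e ∈ f '' (P j ∩ N) → False := by
      rintro i j _ he ⟨e, he', rfl⟩
      exact hfF he'.2 (hKH _ he)
    rintro e ((h1 | h1) | h1) ((h2 | h2) | h2)
    · have hne : ∀ a b : Fin 2, (i, a) ≠ (j, b) := fun a b hab => hij (congrArg Prod.fst hab)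
      obtain h1 | h1 := h1 <;> obtain h2 | h2 := h2 <;>
        exact Set.disjoint_left.1 (hK _ _ (hne _ _)) h1 h2
    · exact hFv (hKH _ h1) (hPv h2)
    · exact hKf h1 h2
    · exact hFv (hKH _ h2) (hPv h1)
    · exact Set.disjoint_left.1 (hP.1.2 i j hij) h1 h2
    · exact hPf h1 h2
    · exact hKf h2 h1
    · exact hPf h2 h1
    · obtain ⟨a, ⟨ha, haN⟩, rfl⟩ := h1
      obtain ⟨b, ⟨hb, hbN⟩, hab⟩ := h2
      rw [hfinj hbN haN hab] at hb
      exact Set.disjoint_left.1 (hP.1.2 i j hij) ha hb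
  have hKconn : ∀ i, ∀ a ∈ T, ∀ b ∈ T, Reaches ends {e ∈ H i | v ∉ ends e} a b :=
    fun i a ha b hb => (hKc (i, 0) a ha b hb).mono fun e he => ⟨hHK i 0 he, hFv (hKF _ he)⟩
  have hback : ∀ i, ∀ e ∈ P i, ∀ z, ends e = s(v, z) →
      Reaches ends {e ∈ H i | v ∉ ends e} z t₀ := by
    intro i e he z hez
    by_cases hz : z ∈ S ∪ R
    · refine hKconn i z ⟨hz, ?_⟩ t₀ ht₀T
      rintro rfl
      exact hloop e (hPv he) (by simp [hez])
    · obtain ⟨t, ht, hfe⟩ := hf e z hz hez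
      have heN : e ∈ N := ⟨z, hz, hez⟩
      have hfeH : f e ∈ {e ∈ H i | v ∉ ends e} := ⟨hHf he heN, hfv heN⟩
      exact (Reaches.of_edge hfeH hfe).trans (hKconn i t ht t₀ ht₀T)
  have hHt₀ : ∀ i, ∀ a ∈ S, Reaches ends (H i) a t₀ := by
    intro i a ha
    by_cases hav : a = v
    · subst hav
      obtain ⟨e, he⟩ := Set.nonempty_of_ncard_ne_zero (show (P i).ncard ≠ 0 by
        have := hP2 i
        omega)
      obtain ⟨z, -, hez⟩ := hPends he
      exact (Reaches.of_edge (hHP i he) hez).trans ((hback i e he z hez).mono fun e he => he.1)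
    · exact (hKconn i a ⟨.inl ha, hav⟩ t₀ ht₀T).mono fun e he => he.1
  refine hno ⟨H, hHdis, fun i a ha b hb => (hHt₀ i a ha).trans (hHt₀ i b hb).symm,
    fun u hu => balanceVertex_of_two_le hk hHdis fun i => ?_,
    fun i => ⟨hHP i, not_isCutVertexOf ht₀v fun e he z hez => ?_⟩⟩
  · by_cases huv : u = v
    · subst huv
      exact (hP2 i).trans (Set.ncard_le_ncard (Set.subset_inter (hP.1.1 i) (hHP i)))
    by_cases hex : ∃ u' ∈ T, u' ≠ u
    · obtain ⟨u', hu', hne⟩ := hex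
      obtain ⟨e, he, heu⟩ := (hKc (i, 0) u ⟨hu, huv⟩ u' hu').exists_incident hne.symm
      obtain ⟨e', he', heu'⟩ := (hKc (i, 1) u ⟨hu, huv⟩ u' hu').exists_incident hne.symm
      have hee : e ≠ e' := by
        rintro rfl
        exact Set.disjoint_left.1 (hK (i, 0) (i, 1) (by simp)) he he'
      rw [← Set.ncard_pair hee]
      refine Set.ncard_le_ncard ?_
      rintro _ (rfl | rfl)
      · exact ⟨heu, hHK _ _ he⟩
      · exact ⟨heu', hHK _ _ he'⟩
    · push Not at hex
      have hPN : ∀ e ∈ P i, u ∉ ends e → e ∈ N ∧ u ∈ ends (f e) := by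
        intro e he heu
        obtain ⟨z, hzv, hez⟩ := hPends he
        have hz : z ∉ S ∪ R := fun hz => heu (by simp [hez, hex z ⟨hz, hzv⟩])
        obtain ⟨t, ht, hfe⟩ := hf e z hz hez
        exact ⟨⟨z, hz, hez⟩, by simp [hfe, hex t ht]⟩
      refine (hP2 i).trans (Set.ncard_le_ncard_of_injOn (fun e => if u ∈ ends e then e else f e)
        (fun e he => ?_) fun e he e' he' hee => ?_)
      · by_cases heu : u ∈ ends e
        · simp only [heu, if_true]
          exact ⟨heu, hHP i he⟩
        · simp only [heu, if_false]
          exact ⟨(hPN e he heu).2, hHf he (hPN e he heu).1⟩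
      · by_cases heu : u ∈ ends e <;> by_cases heu' : u ∈ ends e' <;>
          simp only [heu, heu', if_true, if_false] at hee
        · exact hee
        · exact absurd (hee ▸ hPv he) (hfv (hPN e' he' heu').1)
        · exact absurd (hee ▸ hPv he') (hfv (hPN e he heu).1)
        · exact hfinj (hPN e he heu).1 (hPN e' he' heu').1 hee
  · have hve : v ∈ ends e := by simp [hez]
    obtain (he | he) | ⟨e, he, rfl⟩ := he
    · exact absurd hve (hFv (hKH _ he))
    · exact hback i e he z hez
    · exact absurd hve (hfv he.2)

end SteinerPacking
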